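/- arXiv:1407.7007 — 2 statements merged into one kernel-verified Lean document; each statement's English description precedes it below -/
import Mathlib

section
/- Let p, q be relatively prime positive integers, {F_n} the (p,q)-Fibonacci sequence, and let h, a, d be positive integers and n ≥ 3. Set d_1 = F_a, d_i = F_{h·a + (i−1)·d} for 2 ≤ i ≤ n, and A = {d_1, …, d_n}. If d_3 does not belong to the semigroup ℕd_1 + ℕd_2, then the toric ideal I_A is a complete intersection if and only if n = 3 and 2d divides a. -/
open MvPolynomial

/-- The `(p,q)`-Fibonacci sequence: `F 0 = 0`, `F 1 = 1`, `F (n+2) = p * F (n+1) + q * F n`. -/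
def pqFib (p q : ℕ) : ℕ → ℕ
  | 0 => 0
  | 1 => 1
  | n + 2 => p * pqFib p q (n + 1) + q * pqFib p q n

/-- The `(p,q)`-Lucas sequence: `L 0 = 2`, `L 1 = p`, `L (n+2) = p * L (n+1) + q * L n`. -/
def pqLucas (p q : ℕ) : ℕ → ℕ
  | 0 => 2
  | 1 => p
  | n + 2 => p * pqLucas p q (n + 1) + q * pqLucas p q n

/-- The toric ideal of the affine monomial curve `t ↦ (t^{d 0}, …, t^{d (n-1)})`:
the kernel of the `k`-algebra map `k[x_1,…,x_n] → k[t]`, `x_i ↦ t^{d i}`. -/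
noncomputable def toricIdeal (k : Type*) [Field k] {n : ℕ} (d : Fin n → ℕ) :
    Ideal (MvPolynomial (Fin n) k) :=
  RingHom.ker (MvPolynomial.aeval
    (fun i : Fin n => (Polynomial.X : Polynomial k) ^ d i)).toRingHom

/-- The toric ideal `I_A` is a complete intersection iff it can be generated by
`n - 1` elements. -/
def IsCI (k : Type*) [Field k] {n : ℕ} (d : Fin n → ℕ) : Prop :=
  ∃ g : Fin (n - 1) → MvPolynomial (Fin n) k,
    Ideal.span (Set.range g) = toricIdeal k d

/-- The toric ideal of the projective monomial curve: the kernel of the `k`-algebra map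
`k[x_1,…,x_{n+1}] → k[t,u]`, `x_i ↦ t^{d i} u^{D - d i}` for `i ≤ n` and
`x_{n+1} ↦ u^D`, where `D = max A`. -/
noncomputable def projToricIdeal (k : Type*) [Field k] {n : ℕ} (d : Fin n → ℕ) :
    Ideal (MvPolynomial (Fin (n + 1)) k) :=
  RingHom.ker (MvPolynomial.aeval (fun i : Fin (n + 1) =>
    if h : (i : ℕ) < n then
      (X 0 : MvPolynomial (Fin 2) k) ^ d ⟨i, h⟩ *
        (X 1 : MvPolynomial (Fin 2) k) ^ (Finset.univ.sup d - d ⟨i, h⟩)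
    else (X 1 : MvPolynomial (Fin 2) k) ^ (Finset.univ.sup d))).toRingHom

/-- The projective toric ideal `I_{A*}` is a complete intersection iff it can be
generated by `n - 1` elements. -/
def ProjIsCI (k : Type*) [Field k] {n : ℕ} (d : Fin n → ℕ) : Prop :=
  ∃ g : Fin (n - 1) → MvPolynomial (Fin (n + 1)) k,
    Ideal.span (Set.range g) = projToricIdeal k d

/-- `d 0 < d 1 < ⋯` is a generalized arithmetic sequence: there are positive
integers `h, e` with `d i = h * d 0 + i * e` for every `i ≥ 1`. -/
def IsGenArith {n : ℕ} (d : Fin n → ℕ) : Prop :=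
  ∃ h e : ℕ, 0 < h ∧ 0 < e ∧
    ∀ i : Fin n, 0 < (i : ℕ) → d i = h * d ⟨0, i.pos⟩ + (i : ℕ) * e

/-- `d 0 < d 1 < ⋯` is an increasing arithmetic sequence: there is a positive
integer `e` with `d i = d 0 + i * e` for every `i`. -/
def IsArithFn {n : ℕ} (d : Fin n → ℕ) : Prop :=
  ∃ e : ℕ, 0 < e ∧ ∀ i : Fin n, 0 < (i : ℕ) → d i = d ⟨0, i.pos⟩ + (i : ℕ) * e

/-- `A = {d 0, …, d (n-1)}` minimally generates the numerical semigroup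
`ℕ d 0 + ⋯ + ℕ d (n-1)`: no `d i` lies in the subsemigroup generated by the rest. -/
def MinimallyGenerates {n : ℕ} (d : Fin n → ℕ) : Prop :=
  ∀ i : Fin n, ¬ ∃ α : Fin n → ℕ, α i = 0 ∧ d i = ∑ j, α j * d j

/-- weight of an exponent vector -/
def wt16 {n : ℕ} (d : Fin n → ℕ) (v : Fin n →₀ ℕ) : ℕ := ∑ l, v l * d l

lemma wt16_add {n : ℕ} (d : Fin n → ℕ) (v w : Fin n →₀ ℕ) :
    wt16 d (v + w) = wt16 d v + wt16 d w := by
  simp [wt16, add_mul, Finset.sum_add_distrib]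

lemma wt16_single {n : ℕ} (d : Fin n → ℕ) (i : Fin n) (c : ℕ) :
    wt16 d (Finsupp.single i c) = c * d i := by
  classical
  simp [wt16, Finsupp.single_apply, ite_mul]

lemma aeval16 (k : Type*) [Field k] {n : ℕ} (d : Fin n → ℕ) (v : Fin n →₀ ℕ) (r : k) :
    MvPolynomial.aeval (fun i : Fin n => (Polynomial.X : Polynomial k) ^ d i)
      (monomial v r) = Polynomial.monomial (wt16 d v) r := by
  rw [aeval_monomial, Finsupp.prod_fintype _ _ (by simp)]
  simp only [← pow_mul, wt16]
  rw [Finset.prod_pow_eq_pow_sum, ← Polynomial.C_mul_X_pow_eq_monomial]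
  simp [mul_comm]

lemma mem_toric16 (k : Type*) [Field k] {n : ℕ} (d : Fin n → ℕ) (f : MvPolynomial (Fin n) k) :
    f ∈ toricIdeal k d ↔
      MvPolynomial.aeval (fun i : Fin n => (Polynomial.X : Polynomial k) ^ d i) f = 0 := by
  simp [toricIdeal, RingHom.mem_ker]

lemma binom_mem16 (k : Type*) [Field k] {n : ℕ} (d : Fin n → ℕ) (u w : Fin n →₀ ℕ)
    (h : wt16 d u = wt16 d w) :
    (monomial u 1 - monomial w 1 : MvPolynomial (Fin n) k) ∈ toricIdeal k d := by
  rw [mem_toric16, map_sub, aeval16, aeval16, h, sub_self]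

/-- the functional summing coefficients over `C` -/
noncomputable def phi16 (k : Type*) [Field k] {n : ℕ} (C : (Fin n →₀ ℕ) → Prop) :
    MvPolynomial (Fin n) k →ₗ[k] k := by
  classical
  exact (MvPolynomial.basisMonomials (Fin n) k).constr k (fun m => if C m then 1 else 0)

open Classical in
lemma phi16_mono (k : Type*) [Field k] {n : ℕ} (C : (Fin n →₀ ℕ) → Prop) (m : Fin n →₀ ℕ) :
    phi16 k C (monomial m 1) = if C m then 1 else 0 := by
  have := (MvPolynomial.basisMonomials (Fin n) k).constr_basis k
    (fun m => if C m then (1 : k) else 0) m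
  rw [coe_basisMonomials] at this
  simpa [phi16] using this

lemma phi16_shift (k : Type*) [Field k] {n : ℕ} (d : Fin n → ℕ) (C : (Fin n →₀ ℕ) → Prop) (D : ℕ)
    (hC : ∀ m, C m → wt16 d m = D)
    (hcl : ∀ m m', C m → wt16 d m' = D → (∃ l, m l ≠ 0 ∧ m' l ≠ 0) → C m')
    (m : Fin n →₀ ℕ) (hm : m ≠ 0) (f : MvPolynomial (Fin n) k) (hf : f ∈ toricIdeal k d) :
    phi16 k C (monomial m 1 * f) = 0 := by
  classical
  by_cases hex : ∃ m', C (m + m')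
  · obtain ⟨m0, hm0⟩ := hex
    have hl : ∃ l, m l ≠ 0 := by
      by_contra hne
      push Not at hne
      exact hm (by ext l; simpa using hne l)
    obtain ⟨l, hl⟩ := hl
    have hle : wt16 d m + wt16 d m0 = D := by rw [← wt16_add]; exact hC _ hm0
    have key : (phi16 k C).comp (LinearMap.mulLeft k (monomial m (1:k))) =
        (Polynomial.lcoeff k (wt16 d m0)).comp
          (MvPolynomial.aeval (fun i : Fin n => (Polynomial.X : Polynomial k) ^ d i)).toLinearMap := by
      apply (MvPolynomial.basisMonomials (Fin n) k).ext
      intro m'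
      rw [coe_basisMonomials]
      simp only [LinearMap.comp_apply, LinearMap.mulLeft_apply, AlgHom.toLinearMap_apply,
        aeval16, Polynomial.lcoeff_apply, Polynomial.coeff_monomial, monomial_mul, mul_one,
        phi16_mono]
      have : C (m + m') ↔ wt16 d m' = wt16 d m0 := by
        constructor
        · intro h
          have := hC _ h
          rw [wt16_add] at this; omega
        · intro h
          apply hcl _ _ hm0
          · rw [wt16_add]; omega
          · exact ⟨l, by simp [hl], by simp [hl]⟩
      simp [this]
    have := congrArg (fun g => g f) key
    simp only [LinearMap.comp_apply, LinearMap.mulLeft_apply, AlgHom.toLinearMap_apply] at this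
    rw [this, (mem_toric16 k d f).1 hf]; simp
  · push Not at hex
    have key : (phi16 k C).comp (LinearMap.mulLeft k (monomial m (1:k))) = 0 := by
      apply (MvPolynomial.basisMonomials (Fin n) k).ext
      intro m'
      rw [coe_basisMonomials]
      simp [LinearMap.comp_apply, monomial_mul, phi16_mono, hex m']
    have := congrArg (fun g => g f) key
    simpa [LinearMap.comp_apply, LinearMap.mulLeft_apply] using this

lemma phi16_mul (k : Type*) [Field k] {n : ℕ} (d : Fin n → ℕ) (C : (Fin n →₀ ℕ) → Prop) (D : ℕ)
    (hC : ∀ m, C m → wt16 d m = D)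
    (hcl : ∀ m m', C m → wt16 d m' = D → (∃ l, m l ≠ 0 ∧ m' l ≠ 0) → C m')
    (c f : MvPolynomial (Fin n) k) (hf : f ∈ toricIdeal k d) :
    phi16 k C (c * f) = constantCoeff c * phi16 k C f := by
  classical
  induction c using MvPolynomial.induction_on' with
  | monomial u a =>
    by_cases hu : u = 0
    · subst hu
      have : (monomial 0 a : MvPolynomial (Fin n) k) * f = a • f := by
        rw [MvPolynomial.smul_eq_C_mul]; rfl
      rw [this, map_smul]
      simp
    · have : (monomial u a : MvPolynomial (Fin n) k) * f = a • (monomial u 1 * f) := by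
        rw [← smul_mul_assoc, MvPolynomial.smul_monomial]; simp
      rw [this, map_smul, phi16_shift k d C D hC hcl u hu f hf]
      simp [constantCoeff_monomial, hu]
  | add p q h1 h2 => rw [add_mul, map_add, h1, h2, map_add, add_mul]

lemma indep16 (k : Type*) [Field k] {n N : ℕ} (hN : N < n) (d : Fin n → ℕ)
    (g : Fin N → MvPolynomial (Fin n) k)
    (hg : Ideal.span (Set.range g) = toricIdeal k d)
    (C : Fin n → (Fin n →₀ ℕ) → Prop) (D : Fin n → ℕ)
    (u w : Fin n → (Fin n →₀ ℕ)) (rho : Fin n → ℕ)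
    (hC : ∀ i m, C i m → wt16 d m = D i)
    (hcl : ∀ i m m', C i m → wt16 d m' = D i → (∃ l, m l ≠ 0 ∧ m' l ≠ 0) → C i m')
    (hu : ∀ i, C i (u i)) (hw : ∀ i, ¬ C i (w i)) (huw : ∀ i, wt16 d (u i) = wt16 d (w i))
    (htri : ∀ i l, i ≠ l → rho i ≤ rho l → ¬ C i (u l) ∧ ¬ C i (w l)) : False := by
  classical
  let T : (Fin n → k) →ₗ[k] (Fin N → k) :=
    LinearMap.pi (fun j => ∑ i, (phi16 k (C i) (g j)) • LinearMap.proj i)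
  have hker : T.ker ≠ ⊥ := by
    apply LinearMap.ker_ne_bot_of_finrank_lt
    simpa using hN
  obtain ⟨lam, hlam, hne⟩ := (Submodule.ne_bot_iff _).1 hker
  have hlam' : ∀ j, ∑ i, phi16 k (C i) (g j) * lam i = 0 := by
    intro j
    have := congrFun (LinearMap.mem_ker.1 hlam) j
    simpa [T, LinearMap.sum_apply] using this
  have hgI : ∀ j, g j ∈ toricIdeal k d := by
    intro j; rw [← hg]; exact Ideal.subset_span ⟨j, rfl⟩
  have hall : ∀ f ∈ toricIdeal k d, ∑ i, phi16 k (C i) f * lam i = 0 := by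
    intro f hf
    rw [← hg] at hf
    obtain ⟨c, rfl⟩ := (Ideal.mem_span_range_iff_exists_fun).1 hf
    have : ∀ i, phi16 k (C i) (∑ j, c j * g j) * lam i =
        ∑ j, constantCoeff (c j) * (phi16 k (C i) (g j) * lam i) := by
      intro i
      rw [map_sum, Finset.sum_mul]
      refine Finset.sum_congr rfl fun j _ => ?_
      rw [phi16_mul k d (C i) (D i) (hC i) (hcl i) _ _ (hgI j), mul_assoc]
    simp_rw [this]
    rw [Finset.sum_comm]
    refine Finset.sum_eq_zero fun j _ => ?_
    rw [← Finset.mul_sum, hlam' j, mul_zero]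
  have hnz : (Finset.univ.filter (fun i => lam i ≠ 0)).Nonempty := by
    by_contra hcon
    rw [Finset.not_nonempty_iff_eq_empty, Finset.filter_eq_empty_iff] at hcon
    exact hne (by ext i; simpa using hcon (Finset.mem_univ i))
  obtain ⟨x, hx, hmax⟩ := Finset.exists_max_image _ rho hnz
  have hx0 : lam x ≠ 0 := by simpa using hx
  have h1 := hall _ (binom_mem16 k d (u x) (w x) (huw x))
  rw [Finset.sum_eq_single x] at h1
  · rw [map_sub, phi16_mono, phi16_mono, if_pos (hu x), if_neg (hw x)] at h1
    simp at h1; exact hx0 h1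
  · intro i _ hix
    by_cases hi : lam i = 0
    · simp [hi]
    · obtain ⟨a, b⟩ := htri i x hix (hmax i (by simpa using hi))
      rw [map_sub, phi16_mono, phi16_mono, if_neg a, if_neg b]; simp
  · simp

/-- redundancy -/
def Red16 {n : ℕ} (d : Fin n → ℕ) (i : Fin n) : Prop :=
  ∃ v : Fin n →₀ ℕ, v i = 0 ∧ wt16 d v = d i

/-- `c * d i` lies in the semigroup of the non-multiples of `d i` -/
def Tm16 {n : ℕ} (d : Fin n → ℕ) (i : Fin n) (c : ℕ) : Prop :=
  ∃ v : Fin n →₀ ℕ, (∀ l, d i ∣ d l → v l = 0) ∧ wt16 d v = c * d i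

lemma toric_le16 (k : Type*) [Field k] {n : ℕ} (d : Fin n → ℕ)
    (J : Ideal (MvPolynomial (Fin n) k))
    (hJ : ∀ u w : Fin n →₀ ℕ, wt16 d u = wt16 d w →
      (monomial u 1 - monomial w 1 : MvPolynomial (Fin n) k) ∈ J) : toricIdeal k d ≤ J := by
  classical
  intro f hf
  let rep : ℕ → (Fin n →₀ ℕ) := fun D => if h : ∃ v, wt16 d v = D then h.choose else 0
  have hrep : ∀ v, wt16 d (rep (wt16 d v)) = wt16 d v := by
    intro v
    have h : ∃ v', wt16 d v' = wt16 d v := ⟨v, rfl⟩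
    simp only [rep, dif_pos h]
    exact h.choose_spec
  let Q := MvPolynomial (Fin n) k ⧸ J
  let Psi : Polynomial k →ₗ[k] Q :=
    (Polynomial.basisMonomials k).constr k
      (fun D => Ideal.Quotient.mkₐ k J (monomial (rep D) 1))
  have hPsi : ∀ D, Psi (Polynomial.monomial D 1) =
      Ideal.Quotient.mkₐ k J (monomial (rep D) 1) := by
    intro D
    have := (Polynomial.basisMonomials k).constr_basis k
      (fun D => Ideal.Quotient.mkₐ k J (monomial (rep D) 1)) D
    rw [Polynomial.coe_basisMonomials] at this
    exact this
  have key : (Ideal.Quotient.mkₐ k J).toLinearMap = Psi.comp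
      (MvPolynomial.aeval (fun i : Fin n => (Polynomial.X : Polynomial k) ^ d i)).toLinearMap := by
    apply (MvPolynomial.basisMonomials (Fin n) k).ext
    intro m
    rw [coe_basisMonomials]
    simp only [LinearMap.comp_apply, AlgHom.toLinearMap_apply, aeval16, hPsi]
    rw [← sub_eq_zero, ← map_sub]
    exact Ideal.Quotient.eq_zero_iff_mem.2 (hJ _ _ (hrep m).symm)
  have := congrArg (fun g => g f) key
  simp only [LinearMap.comp_apply, AlgHom.toLinearMap_apply] at this
  rw [(mem_toric16 k d f).1 hf, map_zero] at this
  exact Ideal.Quotient.eq_zero_iff_mem.1 this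
lemma wt16_le {n : ℕ} (d : Fin n → ℕ) (v : Fin n →₀ ℕ) (l : Fin n) : v l * d l ≤ wt16 d v :=
  Finset.single_le_sum (f := fun l => v l * d l) (fun _ _ => Nat.zero_le _) (Finset.mem_univ l)

lemma wt16_dvd {n : ℕ} (d : Fin n → ℕ) (v : Fin n →₀ ℕ) (x : ℕ)
    (h : ∀ l, v l ≠ 0 → x ∣ d l) : x ∣ wt16 d v := by
  apply Finset.dvd_sum
  intro l _
  by_cases hl : v l = 0
  · simp [hl]
  · exact Dvd.dvd.mul_left (h l hl) _

lemma closed16 {n : ℕ} (d : Fin n → ℕ) (hpos : ∀ i, 0 < d i) (i : Fin n) (mm : ℕ)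
    (hmin : ∀ c, 0 < c → Tm16 d i c → mm ≤ c) (m' : Fin n →₀ ℕ)
    (hw : wt16 d m' = mm * d i) (l : Fin n) (hl : m' l ≠ 0) (hdl : d i ∣ d l) :
    ∀ x, m' x ≠ 0 → d i ∣ d x := by
  classical
  intro x hx
  by_contra hdx
  have hsplit : wt16 d (m'.filter (fun y => ¬ d i ∣ d y)) +
      wt16 d (m'.filter (fun y => ¬ ¬ d i ∣ d y)) = wt16 d m' := by
    rw [← wt16_add, Finsupp.filter_add_filter_not]
  have h2 : d i ∣ wt16 d (m'.filter (fun y => ¬ ¬ d i ∣ d y)) := by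
    apply wt16_dvd
    intro y hy
    by_contra hc
    apply hy
    rw [Finsupp.filter_apply, if_neg]; simpa using hc
  have h1 : d i ∣ wt16 d (m'.filter (fun y => ¬ d i ∣ d y)) := by
    rw [← Nat.dvd_add_left h2, hsplit, hw]; exact Dvd.intro_left _ rfl
  obtain ⟨c, hc⟩ := h1
  have hp1 : 0 < wt16 d (m'.filter (fun y => ¬ d i ∣ d y)) := by
    refine lt_of_lt_of_le ?_ (wt16_le d _ x)
    rw [Finsupp.filter_apply, if_pos hdx]
    exact Nat.mul_pos (Nat.pos_of_ne_zero hx) (hpos x)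
  have hp2 : 0 < wt16 d (m'.filter (fun y => ¬ ¬ d i ∣ d y)) := by
    refine lt_of_lt_of_le ?_ (wt16_le d _ l)
    rw [Finsupp.filter_apply, if_pos (by simpa using hdl)]
    exact Nat.mul_pos (Nat.pos_of_ne_zero hl) (hpos l)
  have hc0 : 0 < c := by
    rcases Nat.eq_zero_or_pos c with h | h
    · subst h; simp at hc; omega
    · exact h
  have := hmin c hc0 ⟨m'.filter (fun y => ¬ d i ∣ d y), fun y hy => by rw [Finsupp.filter_apply, if_neg]; simpa using hy,
    by rw [hc, mul_comm]⟩
  have h3 : mm * d i ≤ c * d i := Nat.mul_le_mul_right _ this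
  have h4 := mul_comm (d i) c
  omega

lemma crit16 (k : Type*) [Field k] {n : ℕ} (hn : 0 < n) (d : Fin n → ℕ) (hpos : ∀ i, 0 < d i)
    (hinj : Function.Injective d) (hnd : ∀ i, ∃ l, ¬ d i ∣ d l) (hCI : IsCI k d)
    (e : Fin n → Prop) (E W : Fin n →₀ ℕ) (he : ∀ i l, e i → e l → i = l)
    (hE : (∃ j, e j) → wt16 d E = wt16 d W ∧ W ≠ E ∧
      (∀ m', wt16 d m' = wt16 d E → (∃ l, E l ≠ 0 ∧ m' l ≠ 0) → m' = E) ∧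
      (∀ i, ¬ Red16 d i → (∃ l, E l ≠ 0 ∧ ¬ d i ∣ d l) ∧ (∃ l, W l ≠ 0 ∧ ¬ d i ∣ d l)) ∧
      (∀ r, E ≠ Finsupp.single r 1 ∧ W ≠ Finsupp.single r 1)) :
    ∃ i j, i ≠ j ∧ ¬ e i ∧ ¬ e j ∧ ¬ Red16 d i ∧ ¬ Red16 d j ∧ ∃ M, 0 < M ∧ d i ∣ M ∧ d j ∣ M ∧
      (∀ c, 0 < c → Tm16 d i c → M ≤ c * d i) ∧ (∀ c, 0 < c → Tm16 d j c → M ≤ c * d j) := by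
  classical
  by_contra hcon
  obtain ⟨g, hg⟩ := hCI
  have hex : ∀ i, ∃ c, 0 < c ∧ Tm16 d i c := by
    intro i
    obtain ⟨l, hl⟩ := hnd i
    refine ⟨d l, hpos l, Finsupp.single l (d i), ?_, ?_⟩
    · intro x hx
      rw [Finsupp.single_apply, if_neg]
      rintro rfl; exact hl hx
    · rw [wt16_single, mul_comm]
  have hm : ∀ i, ∃ mm, 0 < mm ∧ Tm16 d i mm ∧ ∀ c, 0 < c → Tm16 d i c → mm ≤ c := by
    intro i
    exact ⟨Nat.find (hex i), (Nat.find_spec (hex i)).1, (Nat.find_spec (hex i)).2,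
      fun c h1 h2 => Nat.find_min' (hex i) ⟨h1, h2⟩⟩
  choose mm hmpos hmT hmin using hm
  choose w0 hw0 hw0' using hmT
  have hr : ∀ i, ∃ v : Fin n →₀ ℕ, Red16 d i → v i = 0 ∧ wt16 d v = d i := by
    intro i
    by_cases h : Red16 d i
    · obtain ⟨v, hv⟩ := h; exact ⟨v, fun _ => hv⟩
    · exact ⟨0, fun h' => absurd h' h⟩
  choose v0 hv0 using hr
  let C : Fin n → (Fin n →₀ ℕ) → Prop := fun i m =>
    if e i then m = E else if Red16 d i then m = Finsupp.single i 1 else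
      (wt16 d m = mm i * d i ∧ ∀ l, m l ≠ 0 → d i ∣ d l)
  let u : Fin n → (Fin n →₀ ℕ) := fun i => if e i then E else if Red16 d i then
    Finsupp.single i 1 else Finsupp.single i (mm i)
  let w : Fin n → (Fin n →₀ ℕ) := fun i => if e i then W else if Red16 d i then v0 i else w0 i
  let rho : Fin n → ℕ := fun i => if e i then 2 else if Red16 d i then 0 else 1
  have w0ne : ∀ i, ∃ l, w0 i l ≠ 0 := by
    intro i
    by_contra hc
    push Not at hc
    have : wt16 d (w0 i) = 0 := by simp [wt16, hc]
    rw [hw0' i] at this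
    have := Nat.mul_pos (hmpos i) (hpos i)
    omega
  have nred : ∀ i l, ¬ Red16 d l → d i ∣ d l → i = l := by
    intro i l hl hdvd
    by_contra hne
    obtain ⟨c, hc⟩ := hdvd
    apply hl
    refine ⟨Finsupp.single i c, ?_, ?_⟩
    · rw [Finsupp.single_apply, if_neg hne]
    · rw [wt16_single, hc, mul_comm]
  refine indep16 k (by omega : n - 1 < n) d g hg C (fun i => wt16 d (u i)) u w rho ?_ ?_ ?_ ?_ ?_ ?_
  · intro i m h
    simp only [C, u] at h ⊢
    split_ifs at h ⊢ with h1 h2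
    · rw [h]
    · rw [h]
    · rw [h.1, wt16_single]
  · intro i m m' h hwt hsh
    simp only [C, u] at h hwt ⊢
    split_ifs at h hwt ⊢ with h1 h2
    · subst h
      exact (hE ⟨i, h1⟩).2.2.1 m' hwt hsh
    · subst h
      obtain ⟨l, hl, hl'⟩ := hsh
      have hil : i = l := by
        by_contra hne
        apply hl; rw [Finsupp.single_apply, if_neg hne]
      subst hil
      rw [wt16_single, one_mul] at hwt
      have hle : Finsupp.single i 1 ≤ m' := by
        rw [Finsupp.single_le_iff]; omega
      obtain ⟨r, rfl⟩ := exists_add_of_le hle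
      rw [wt16_add, wt16_single] at hwt
      have hr0 : r = 0 := by
        ext x
        have := wt16_le d r x
        have h0 : r x * d x = 0 := by omega
        rcases Nat.mul_eq_zero.1 h0 with h | h
        · simpa using h
        · have := hpos x; omega
      rw [hr0, add_zero]
    · rw [wt16_single] at hwt
      obtain ⟨l, hl, hl'⟩ := hsh
      exact ⟨hwt, closed16 d hpos i (mm i) (hmin i) m' hwt l hl' (h.2 l hl)⟩
  · intro i
    simp only [C, u]
    split_ifs with h1 h2
    · rfl
    · rfl
    · refine ⟨wt16_single _ _ _, ?_⟩
      intro l hl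
      have hil : i = l := by
        by_contra hne
        apply hl; rw [Finsupp.single_apply, if_neg hne]
      rw [hil]
  · intro i
    simp only [C, w]
    split_ifs with h1 h2
    · exact (hE ⟨i, h1⟩).2.1
    · intro h
      have := (hv0 i h2).1
      rw [h] at this; simp at this
    · rintro ⟨_, h⟩
      obtain ⟨l, hl⟩ := w0ne i
      exact hl (hw0 i l (h l hl))
  · intro i
    simp only [u, w]
    split_ifs with h1 h2
    · exact (hE ⟨i, h1⟩).1
    · rw [wt16_single, (hv0 i h2).2, one_mul]
    · rw [wt16_single, hw0']
  · intro i l hil hrho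
    by_cases hei : e i
    · have hel : ¬ e l := fun h => hil (he i l hei h)
      exfalso
      simp only [rho, if_pos hei, if_neg hel] at hrho
      split_ifs at hrho <;> omega
    by_cases hri : Red16 d i
    · simp only [C, if_neg hei, if_pos hri, u, w]
      split_ifs with h1 h2
      · exact (hE ⟨l, h1⟩).2.2.2.2 i
      · constructor
        · intro h
          have := congrArg (fun f => f i) h
          simp only [Finsupp.single_apply] at this
          rw [if_neg (Ne.symm hil)] at this; simp at this
        · intro h
          have := (hv0 l h2).2
          rw [h, wt16_single, one_mul] at this
          exact hil (hinj this)
      · constructor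
        · intro h
          have := congrArg (fun f => f i) h
          simp only [Finsupp.single_apply] at this
          rw [if_neg (Ne.symm hil)] at this; simp at this
        · intro h
          have h3 := hw0' l
          rw [h, wt16_single, one_mul] at h3
          have h4 := hw0 l i ⟨mm l, by rw [h3, mul_comm]⟩
          rw [h] at h4; simp at h4
    · simp only [C, if_neg hei, if_neg hri, u, w]
      split_ifs with h1 h2
      · obtain ⟨⟨a, ha, ha'⟩, ⟨b, hb, hb'⟩⟩ := (hE ⟨l, h1⟩).2.2.2.1 i hri
        exact ⟨fun h => ha' (h.2 a ha), fun h => hb' (h.2 b hb)⟩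
      · exfalso
        simp only [rho, if_neg hei, if_neg hri, if_neg h1, if_pos h2] at hrho
        omega
      · constructor
        · rintro ⟨_, h⟩
          refine hil (nred i l h2 (h l ?_))
          simpa using (hmpos l).ne'
        · rintro ⟨h, _⟩
          rw [hw0' l] at h
          apply hcon
          refine ⟨i, l, hil, hei, h1, hri, h2, mm i * d i, Nat.mul_pos (hmpos i) (hpos i),
            Dvd.intro_left _ rfl, h ▸ Dvd.intro_left _ rfl, ?_, ?_⟩
          · intro c hc hT
            exact Nat.mul_le_mul_right _ (hmin i c hc hT)
          · intro c hc hT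
            rw [← h]
            exact Nat.mul_le_mul_right _ (hmin l c hc hT)
set_option linter.unusedSectionVars false

section fib16
variable (p q : ℕ)

lemma fr16 (m : ℕ) : pqFib p q (m + 2) = p * pqFib p q (m + 1) + q * pqFib p q m := rfl
lemma f0_16 : pqFib p q 0 = 0 := rfl
lemma f1_16 : pqFib p q 1 = 1 := rfl

lemma fadd16 (m : ℕ) : ∀ n, pqFib p q (m + n + 1) =
    pqFib p q (m + 1) * pqFib p q (n + 1) + q * (pqFib p q m * pqFib p q n)
  | 0 => by simp [f0_16, f1_16]
  | 1 => by
    have := fr16 p q m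
    have h2 := fr16 p q 0
    simp only [f0_16, f1_16, Nat.zero_add] at h2 
    rw [h2, f1_16, show m + 1 + 1 = m + 2 from rfl, this]; ring
  | n + 2 => by
    have h1 := fadd16 m n
    have h2 := fadd16 m (n + 1)
    have e1 : pqFib p q (m + (n + 2) + 1) =
      p * pqFib p q (m + (n + 1) + 1) + q * pqFib p q (m + n + 1) := fr16 p q (m + n + 1)
    have e2 : pqFib p q (n + 2 + 1) = p * pqFib p q (n + 1 + 1) + q * pqFib p q (n + 1) :=
      fr16 p q (n + 1)
    have e3 := fr16 p q n
    rw [e1, h1, h2, e2, e3]; ring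

variable {p q} (hp : 0 < p) (hq : 0 < q)
include hp hq

lemma fpos16 : ∀ n, 0 < n → 0 < pqFib p q n
  | 0, h => by omega
  | 1, _ => by simp [f1_16]
  | n + 2, _ => by
    have := fpos16 (n + 1) (by omega)
    rw [fr16]; positivity

lemma fle_succ16 (n : ℕ) : pqFib p q n ≤ pqFib p q (n + 1) := by
  cases n with
  | zero => simp [f0_16]
  | succ m =>
    show pqFib p q (m + 1) ≤ pqFib p q (m + 2)
    rw [fr16]
    nlinarith [Nat.zero_le (pqFib p q (m + 1)), Nat.zero_le (q * pqFib p q m)]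

lemma fmono16 : Monotone (pqFib p q) := monotone_nat_of_le_succ (fle_succ16 hp hq)

lemma flt_succ16 (n : ℕ) (hn : 2 ≤ n) : pqFib p q n < pqFib p q (n + 1) := by
  obtain ⟨m, rfl⟩ : ∃ m, n = m + 2 := ⟨n - 2, by omega⟩
  show _ < pqFib p q (m + 1 + 2)
  rw [fr16 p q (m + 1)]
  have := fpos16 hp hq (m + 1) (by omega)
  have : 0 < q * pqFib p q (m + 1) := by positivity
  show pqFib p q (m + 2) < p * pqFib p q (m + 2) + _
  nlinarith [Nat.zero_le (pqFib p q (m + 2))]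

lemma flt16 {m n : ℕ} (h : m < n) (hn : 3 ≤ n) : pqFib p q m < pqFib p q n := by
  calc pqFib p q m ≤ pqFib p q (n - 1) := fmono16 hp hq (by omega)
    _ < pqFib p q (n - 1 + 1) := flt_succ16 hp hq _ (by omega)
    _ = _ := by rw [Nat.sub_add_cancel (by omega)]

lemma flt16' {m n : ℕ} (h : m < n) (hn : 2 ≤ pqFib p q n) : pqFib p q m < pqFib p q n := by
  by_cases h3 : 3 ≤ n
  · exact flt16 hp hq h h3
  · have : pqFib p q m ≤ 1 := by
      have : pqFib p q m ≤ pqFib p q 1 := fmono16 hp hq (by omega)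
      simpa [f1_16] using this
    omega

omit hp hq in
/-- `F (x + y) = F (y+1) F x + q F y F (x-1)` -/
lemma fadd16' (x y : ℕ) (hx : 0 < x) : pqFib p q (x + y) =
    pqFib p q (y + 1) * pqFib p q x + q * (pqFib p q y * pqFib p q (x - 1)) := by
  obtain ⟨z, rfl⟩ : ∃ z, x = z + 1 := ⟨x - 1, by omega⟩
  have := fadd16 p q y z
  rw [show z + 1 + y = y + z + 1 by ring, this]; simp

omit hp hq in
lemma fge16 (x y : ℕ) : pqFib p q (y + 1) * pqFib p q x ≤ pqFib p q (x + y) := by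
  rcases Nat.eq_zero_or_pos x with h | h
  · subst h; simp [f0_16]
  · rw [fadd16' x y h]; omega

omit hp hq in
lemma fdvd16 (m : ℕ) : ∀ c, pqFib p q m ∣ pqFib p q (m * c)
  | 0 => by simp [f0_16]
  | c + 1 => by
    rcases Nat.eq_zero_or_pos m with h | h
    · subst h; simp
    · rw [Nat.mul_succ, add_comm, fadd16' _ _ h]
      exact dvd_add (Dvd.intro_left _ rfl) ((Dvd.dvd.mul_right (fdvd16 m c) _).mul_left _)

omit hp hq in
lemma fdvd16' {m n : ℕ} (h : m ∣ n) : pqFib p q m ∣ pqFib p q n := by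
  obtain ⟨c, rfl⟩ := h; exact fdvd16 m c

omit hp hq in
lemma fcopq16 (hpq : Nat.gcd p q = 1) : ∀ n, Nat.Coprime (pqFib p q (n + 1)) q
  | 0 => by simp [f1_16]
  | n + 1 => by
    show Nat.Coprime (pqFib p q (n + 2)) q
    rw [fr16, Nat.coprime_add_mul_left_left]
    exact Nat.Coprime.mul_left hpq (fcopq16 hpq n)

omit hp hq in
lemma fcops16 (hpq : Nat.gcd p q = 1) : ∀ n, Nat.Coprime (pqFib p q (n + 1)) (pqFib p q n)
  | 0 => by simp [f1_16]
  | n + 1 => by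
    show Nat.Coprime (pqFib p q (n + 2)) _
    rw [fr16, add_comm, Nat.coprime_add_mul_right_left]
    exact Nat.Coprime.mul_left ((fcopq16 hpq n).symm) (fcops16 hpq n).symm

omit hp hq in
lemma fgcd_add16 (hpq : Nat.gcd p q = 1) (m n : ℕ) :
    Nat.gcd (pqFib p q m) (pqFib p q (n + m)) = Nat.gcd (pqFib p q m) (pqFib p q n) := by
  rcases Nat.eq_zero_or_pos m with h | h
  · subst h; simp
  obtain ⟨m, rfl⟩ : ∃ z, m = z + 1 := ⟨m - 1, by omega⟩
  rw [add_comm n, fadd16' (m + 1) n (by omega), Nat.add_sub_cancel]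
  rw [Nat.gcd_mul_right_add_right]
  have h1 : Nat.Coprime (pqFib p q (m + 1)) (q * pqFib p q m) :=
    Nat.Coprime.mul_right (fcopq16 hpq m) (fcops16 hpq m)
  rw [show q * (pqFib p q n * pqFib p q m) = (q * pqFib p q m) * pqFib p q n by ring]
  exact Nat.Coprime.gcd_mul_left_cancel_right _ h1.symm

omit hp hq in
lemma fgcd16 (hpq : Nat.gcd p q = 1) (m n : ℕ) :
    Nat.gcd (pqFib p q m) (pqFib p q n) = pqFib p q (Nat.gcd m n) := by
  induction m, n using Nat.gcd.induction with
  | H0 n => simp [f0_16]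
  | H1 m n hm ih =>
    have hrep : ∀ c, Nat.gcd (pqFib p q m) (pqFib p q (n % m + m * c)) =
        Nat.gcd (pqFib p q m) (pqFib p q (n % m)) := by
      intro c
      induction c with
      | zero => simp
      | succ c ihc => rw [Nat.mul_succ, ← add_assoc, fgcd_add16 hpq, ihc]
    have h1 := hrep (n / m)
    rw [Nat.mod_add_div] at h1
    rw [h1, Nat.gcd_comm, ih, Nat.gcd_rec m n]

/-- Lucas-type number -/
def L16 (p q d : ℕ) : ℕ := pqFib p q (d + 1) + q * pqFib p q (d - 1)

omit hp hq in
lemma cass16 : ∀ m : ℕ, (pqFib p q (m + 1) : ℤ) ^ 2 - pqFib p q m * pqFib p q (m + 2) = (-q) ^ m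
  | 0 => by simp [f0_16, f1_16]
  | m + 1 => by
    have ih := cass16 m
    have e1 : (pqFib p q (m + 1 + 2) : ℤ) = p * pqFib p q (m + 2) + q * pqFib p q (m + 1) := by
      exact_mod_cast fr16 p q (m + 1)
    have e2 : (pqFib p q (m + 2) : ℤ) = p * pqFib p q (m + 1) + q * pqFib p q m := by
      exact_mod_cast fr16 p q m
    rw [e1, pow_succ (-(q : ℤ)) m, ← ih]
    show (pqFib p q (m + 2) : ℤ) ^ 2 - _ = _
    rw [e2]; ring

omit hp hq in
lemma f2d16 (d : ℕ) (hd : 0 < d) : pqFib p q (2 * d) = L16 p q d * pqFib p q d := by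
  have := fadd16' (p := p) (q := q) d d hd
  rw [two_mul, this, L16]; ring

omit hp hq in
lemma fluc16 (d : ℕ) (hd : 0 < d) : ∀ x : ℕ,
    (pqFib p q (x + 2 * d) : ℤ) + (-q) ^ d * pqFib p q x = L16 p q d * pqFib p q (x + d)
  | 0 => by
    have := f2d16 (p := p) (q := q) d hd
    simp [f0_16, this]
  | 1 => by
    obtain ⟨m, rfl⟩ : ∃ m, d = m + 1 := ⟨d - 1, by omega⟩
    have h1 := cass16 (p := p) (q := q) m
    have h2 := fadd16 p q (m + 1) (m + 1)
    rw [show 1 + 2 * (m + 1) = m + 1 + (m + 1) + 1 by ring, h2, L16, Nat.add_sub_cancel, pow_succ,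
      ← h1, f1_16, show 1 + (m + 1) = m + 2 by ring]
    push_cast
    rw [show m + 1 + 1 = m + 2 by ring]
    ring
  | x + 2 => by
    have h1 := fluc16 d hd x
    have h2 := fluc16 d hd (x + 1)
    have e1 : (pqFib p q (x + 2 + 2 * d) : ℤ) =
        p * pqFib p q (x + 1 + 2 * d) + q * pqFib p q (x + 2 * d) := by
      rw [show x + 2 + 2 * d = (x + 2 * d) + 2 by ring, show x + 1 + 2 * d = (x + 2 * d) + 1 by ring]
      exact_mod_cast fr16 p q (x + 2 * d)
    have e2 : (pqFib p q (x + 2 + d) : ℤ) =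
        p * pqFib p q (x + 1 + d) + q * pqFib p q (x + d) := by
      rw [show x + 2 + d = (x + d) + 2 by ring, show x + 1 + d = (x + d) + 1 by ring]
      exact_mod_cast fr16 p q (x + d)
    have e3 : (pqFib p q (x + 2) : ℤ) = p * pqFib p q (x + 1) + q * pqFib p q x := by
      exact_mod_cast fr16 p q x
    rw [e1, e2, e3]; linear_combination (p : ℤ) * h2 + (q : ℤ) * h1

omit hp hq in
lemma flucE16 (d : ℕ) (hd : 0 < d) (he : Even d) (x : ℕ) :
    pqFib p q (x + 2 * d) + q ^ d * pqFib p q x = L16 p q d * pqFib p q (x + d) := by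
  have := fluc16 (p := p) (q := q) d hd x
  rw [he.neg_pow] at this
  exact_mod_cast this

omit hp hq in
lemma flucO16 (d : ℕ) (ho : Odd d) (x : ℕ) :
    pqFib p q (x + 2 * d) = L16 p q d * pqFib p q (x + d) + q ^ d * pqFib p q x := by
  have := fluc16 (p := p) (q := q) d ho.pos x
  rw [ho.neg_pow] at this
  have h2 : (pqFib p q (x + 2 * d) : ℤ) = L16 p q d * pqFib p q (x + d) + q ^ d * pqFib p q x := by
    linarith
  exact_mod_cast h2

omit hp hq in
/-- d'Ocagne -/
lemma docagne16 (z : ℕ) : ∀ y : ℕ,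
    (pqFib p q y : ℤ) * pqFib p q (y + 1 + z) - pqFib p q (y + 1) * pqFib p q (y + z)
      = - (-q) ^ y * pqFib p q z
  | 0 => by simp [f0_16, f1_16]
  | y + 1 => by
    have ih := docagne16 z y
    have e1 : (pqFib p q (y + 1 + 1 + z) : ℤ) =
        p * pqFib p q (y + 1 + z) + q * pqFib p q (y + z) := by
      rw [show y + 1 + 1 + z = (y + z) + 2 by ring, show y + 1 + z = (y + z) + 1 by ring]
      exact_mod_cast fr16 p q (y + z)
    have e2 : (pqFib p q (y + 1 + 1) : ℤ) = p * pqFib p q (y + 1) + q * pqFib p q y := by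
      exact_mod_cast fr16 p q y
    rw [e1, e2, pow_succ]; linear_combination (-(q : ℤ)) * ih

/-- monotonicity of quotients, odd start -/
lemma quotO16 (d x y : ℕ) (hy : Odd y) (hxy : y ≤ x) :
    pqFib p q (y + d) * pqFib p q x ≤ pqFib p q (x + d) * pqFib p q y := by
  obtain ⟨z, rfl⟩ := exists_add_of_le hxy
  obtain ⟨t, rfl⟩ : ∃ t, y = t + 1 := ⟨y - 1, by have := hy.pos; omega⟩
  have ht : Even t := by rcases hy with ⟨r, hr⟩; exact ⟨r, by omega⟩
  have h1 := docagne16 (p := p) (q := q) z t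
  rw [ht.neg_pow] at h1
  have h2 : pqFib p q t * pqFib p q (t + 1 + z) ≤ pqFib p q (t + 1) * pqFib p q (t + z) := by
    zify
    have : (0 : ℤ) ≤ (q : ℤ) ^ t * pqFib p q z := by positivity
    linarith
  rw [fadd16' (t + 1) d (by omega), fadd16' (t + 1 + z) d (by omega), Nat.add_sub_cancel,
    show t + 1 + z - 1 = t + z by omega]
  have h3 := Nat.mul_le_mul_left (q * pqFib p q d) h2
  nlinarith [h3]

/-- even start -/
lemma quotE16 (d x y : ℕ) (hd : 0 < d) (hy : Even y) (hy0 : 0 < y) (hxy : y < x) :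
    pqFib p q (x + d) * pqFib p q y < pqFib p q (y + d) * pqFib p q x := by
  obtain ⟨z, rfl⟩ := exists_add_of_le hxy.le
  obtain ⟨t, rfl⟩ : ∃ t, y = t + 1 := ⟨y - 1, by omega⟩
  have ht : Odd t := by rcases hy with ⟨r, hr⟩; exact ⟨r - 1, by omega⟩
  have h1 := docagne16 (p := p) (q := q) z t
  rw [ht.neg_pow] at h1
  have hz := fpos16 hp hq z (by omega)
  have h2 : pqFib p q (t + 1) * pqFib p q (t + z) < pqFib p q t * pqFib p q (t + 1 + z) := by
    zify
    have : (0 : ℤ) < (q : ℤ) ^ t * pqFib p q z := by positivity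
    linarith
  rw [fadd16' (t + 1) d (by omega), fadd16' (t + 1 + z) d (by omega), Nat.add_sub_cancel,
    show t + 1 + z - 1 = t + z by omega]
  have hfd := fpos16 hp hq d hd
  have h3 := Nat.mul_lt_mul_of_pos_left h2 (show 0 < q * pqFib p q d by positivity)
  nlinarith [h3]

lemma La16 (y d : ℕ) (hd : 0 < d) (hy : 2 ≤ y) : L16 p q d * pqFib p q y < pqFib p q (y + d + 1) := by
  rw [fadd16, L16]
  have h1 := flt_succ16 hp hq y hy
  have h2 : pqFib p q (d - 1) ≤ pqFib p q d := fmono16 hp hq (by omega)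
  have h3 := fpos16 hp hq (d + 1) (by omega)
  have h4 : pqFib p q (d + 1) * pqFib p q y < pqFib p q (y + 1) * pqFib p q (d + 1) := by
    rw [mul_comm]; exact Nat.mul_lt_mul_of_pos_right h1 h3
  have h5 := Nat.mul_le_mul_left (q * pqFib p q y) h2
  nlinarith

lemma fd1_16 (d : ℕ) (hd : 2 ≤ d) : 2 ≤ pqFib p q (d + 1) := by
  have h1 := flt_succ16 hp hq d hd
  have h2 := fpos16 hp hq d (by omega)
  omega

lemma Lb16 (d : ℕ) (hd : 2 ≤ d) : L16 p q d + 2 ≤ pqFib p q (2 * d + 1) := by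
  have h0 := fadd16 p q d d
  rw [show d + d + 1 = 2 * d + 1 by ring] at h0
  rw [h0, L16]
  have h1 := fd1_16 hp hq d hd
  have h2 : pqFib p q (d - 1) ≤ pqFib p q d := fmono16 hp hq (by omega)
  have h3 := fpos16 hp hq d (by omega)
  have h4 : pqFib p q (d - 1) ≤ pqFib p q d * pqFib p q d := by nlinarith
  have h5 := Nat.mul_le_mul_left q h4
  nlinarith

lemma Lc16 (d : ℕ) (hd : 0 < d) : L16 p q d ≤ 2 * pqFib p q (d + 1) := by
  obtain ⟨m, rfl⟩ : ∃ m, d = m + 1 := ⟨d - 1, by omega⟩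
  have := fr16 p q m
  rw [L16, Nat.add_sub_cancel]
  show pqFib p q (m + 2) + _ ≤ 2 * pqFib p q (m + 2)
  have : 0 ≤ p * pqFib p q (m + 1) := Nat.zero_le _
  omega

lemma Ld16 (d : ℕ) (hd : 2 ≤ d) : 3 ≤ L16 p q d := by
  have h1 := fd1_16 hp hq d hd
  have h2 := fpos16 hp hq (d - 1) (by omega)
  have : 0 < q * pqFib p q (d - 1) := by positivity
  rw [L16]; omega

lemma Le16 (hpq : Nat.gcd p q = 1) (d : ℕ) : Nat.Coprime (L16 p q d) q := by
  rw [L16, Nat.coprime_add_mul_left_left]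
  exact fcopq16 hpq d

lemma f3d16 (d : ℕ) (hd : 0 < d) (he : Even d) :
    pqFib p q (3 * d) + q ^ d * pqFib p q d = L16 p q d * (L16 p q d * pqFib p q d) := by
  have := flucE16 (p := p) (q := q) d hd he d
  rw [show d + d = 2 * d by ring, f2d16 d hd] at this
  rw [← this, show d + 2 * d = 3 * d by ring]

lemma Lf16 (d : ℕ) (hd : 2 ≤ d) (he : Even d) :
    q ^ d + L16 p q d + 2 ≤ L16 p q d * L16 p q d := by
  have h1 := f3d16 hp hq d (by omega) he
  have h2 := fge16 (p := p) (q := q) d (2 * d)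
  rw [show d + 2 * d = 3 * d by ring] at h2
  have h3 := Lb16 hp hq d hd
  have h4 := fpos16 hp hq d (by omega)
  have h5 := Nat.mul_le_mul_right (pqFib p q d) h3
  have h6 : (q ^ d + L16 p q d + 2) * pqFib p q d ≤ (L16 p q d * L16 p q d) * pqFib p q d := by
    nlinarith
  exact Nat.le_of_mul_le_mul_right h6 h4

lemma pair01a16 (h a d : ℕ) (ha : 0 < a) (hd : 0 < d) (he : Even d) (hh : 0 < h)
    (hnd : ¬ a ∣ 2 * d) (hle : pqFib p q a ≤ L16 p q d * pqFib p q (Nat.gcd a d)) :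
    pqFib p q a * pqFib p q (h * a + d) ≤ pqFib p q (h * a + 2 * d) * pqFib p q (Nat.gcd a d) := by
  have hd2 : 2 ≤ d := by rcases he with ⟨r, hr⟩; omega
  set y := Nat.gcd a d with hy
  have hya : y ∣ a := Nat.gcd_dvd_left _ _
  have hyd : y ∣ d := Nat.gcd_dvd_right _ _
  have hy0 : 0 < y := Nat.gcd_pos_of_pos_left _ ha
  have hyled : y ≤ d := Nat.le_of_dvd hd hyd
  have hylea : y ≤ a := Nat.le_of_dvd ha hya
  have hyp := fpos16 hp hq y hy0
  have hx : pqFib p q (h * a + 2 * d) = pqFib p q (h * a + d + d) := by congr 1; ring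
  have hge := fge16 (p := p) (q := q) (h * a + d) d
  rcases lt_trichotomy a (y + d) with hlt | heq | hgt
  · rw [hx]
    have h1 : pqFib p q a ≤ pqFib p q (y + (d - 1)) := fmono16 hp hq (by omega)
    rw [fadd16' y (d - 1) hy0, Nat.sub_add_cancel hd] at h1
    have h2 : pqFib p q (y - 1) ≤ pqFib p q y := fmono16 hp hq (by omega)
    have h3 := fr16 p q (d - 1)
    rw [show d - 1 + 2 = d + 1 by omega, Nat.sub_add_cancel hd] at h3
    have h4 : pqFib p q a ≤ pqFib p q (d + 1) * pqFib p q y := by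
      have h5 := Nat.mul_le_mul_left (q * pqFib p q (d - 1)) h2
      have h6 : pqFib p q d ≤ p * pqFib p q d := Nat.le_mul_of_pos_left _ hp
      have h7 := Nat.mul_le_mul_right (pqFib p q y) h6
      rw [h3]; nlinarith
    calc pqFib p q a * pqFib p q (h * a + d)
        ≤ (pqFib p q (d + 1) * pqFib p q y) * pqFib p q (h * a + d) := Nat.mul_le_mul_right _ h4
      _ = (pqFib p q (d + 1) * pqFib p q (h * a + d)) * pqFib p q y := by ring
      _ ≤ _ := Nat.mul_le_mul_right _ hge
  · rcases Nat.even_or_odd y with hev | hod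
    · exfalso
      have hyd' : y < d := by
        rcases lt_or_eq_of_le hyled with h1 | h1
        · exact h1
        · exact absurd ⟨1, by omega⟩ hnd
      have h1 := quotE16 hp hq d d y hd hev hy0 hyd'
      rw [show d + d = 2 * d by ring, f2d16 d hd, ← heq] at h1
      have h2 := fpos16 hp hq d hd
      have h3 := Nat.mul_le_mul_right (pqFib p q d) hle
      nlinarith
    · have h1 := quotO16 hp hq d (h * a + d) y hod (by omega)
      rw [← heq] at h1
      rw [hx]; exact h1
  · exfalso
    have h0 : pqFib p q (y + d + 1) ≤ pqFib p q a := fmono16 hp hq (by omega)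
    by_cases hy2 : 2 ≤ y
    · have := La16 hp hq y d hd hy2
      omega
    · have hy1 : y = 1 := by omega
      rw [hy1] at h0 hle hgt
      rw [f1_16, mul_one, L16] at hle
      have h6 := fr16 p q d
      rw [show 1 + d + 1 = d + 2 by ring] at h0
      have h7 : pqFib p q (d + 1) ≤ p * pqFib p q (d + 1) := Nat.le_mul_of_pos_left _ hp
      by_cases hd3 : 3 ≤ d
      · have h8 : pqFib p q (d - 1) < pqFib p q d := flt16 hp hq (by omega) hd3
        have h9 := Nat.mul_lt_mul_of_pos_left h8 hq
        omega
      · have hd' : d = 2 := by omega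
        subst hd'
        rcases lt_or_eq_of_le (show 4 ≤ a by omega) with h4 | h4
        · have h8 : pqFib p q 4 < pqFib p q a := flt16 hp hq h4 (by omega)
          have h9 : pqFib p q (2 - 1) ≤ pqFib p q 2 := fmono16 hp hq (by omega)
          have h10 := Nat.mul_le_mul_left q h9
          simp only [Nat.reduceAdd, Nat.reduceSub] at h0 h6 h7 h8 h9 h10 hle
          omega
        · exact hnd ⟨1, by omega⟩

lemma pair01_16 (hpq : Nat.gcd p q = 1) (h a d : ℕ) (ha : 0 < a) (hd : 0 < d) (he : Even d)
    (hh : 0 < h) (hnd : ¬ a ∣ 2 * d)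
    (hle : Nat.lcm (pqFib p q a) (pqFib p q (h * a + d)) ≤ L16 p q d * pqFib p q (h * a + d)) :
    ∃ α β : ℕ, pqFib p q (h * a + 2 * d) = α * pqFib p q a + β * pqFib p q (h * a + d) := by
  have hg : Nat.gcd (pqFib p q a) (pqFib p q (h * a + d)) = pqFib p q (Nat.gcd a d) := by
    rw [fgcd16 hpq]; congr 1; simp
  have hD1 := fpos16 hp hq (h * a + d) (by omega)
  have hy := fpos16 hp hq (Nat.gcd a d) (Nat.gcd_pos_of_pos_left _ ha)
  obtain ⟨m, hm⟩ : pqFib p q (Nat.gcd a d) ∣ pqFib p q a := fdvd16' (Nat.gcd_dvd_left _ _)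
  obtain ⟨b, hb⟩ : pqFib p q (Nat.gcd a d) ∣ pqFib p q (h * a + d) := by
    rw [← hg]; exact Nat.gcd_dvd_right _ _
  have hmul := Nat.gcd_mul_lcm (pqFib p q a) (pqFib p q (h * a + d))
  rw [hg] at hmul
  have hle2 : pqFib p q a ≤ L16 p q d * pqFib p q (Nat.gcd a d) := by
    have h1 := Nat.mul_le_mul_left (pqFib p q (Nat.gcd a d)) hle
    rw [hmul] at h1
    apply Nat.le_of_mul_le_mul_right (c := pqFib p q (h * a + d)) _ hD1
    linarith [h1]
  have h2 := pair01a16 hp hq h a d ha hd he hh hnd hle2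
  have hm0 : 0 < m := by
    rcases Nat.eq_zero_or_pos m with h0 | h0
    · have := fpos16 hp hq a ha
      rw [hm, h0] at this; simp at this
    · exact h0
  have h3 : m * pqFib p q (h * a + d) ≤ pqFib p q (h * a + 2 * d) := by
    refine le_of_mul_le_mul_left (a := pqFib p q (Nat.gcd a d)) ?_ hy
    calc _ = pqFib p q a * pqFib p q (h * a + d) := by rw [hm]; ring
      _ ≤ _ := h2
      _ = _ := by ring
  have h4 := flucE16 (p := p) (q := q) d hd he (h * a)
  obtain ⟨c, hc⟩ : pqFib p q a ∣ pqFib p q (h * a) := fdvd16' (Dvd.intro_left _ rfl)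
  set L := L16 p q d
  set D1 := pqFib p q (h * a + d) with hD1def
  set D2 := pqFib p q (h * a + 2 * d) with hD2def
  have hr : L % m < m := Nat.mod_lt _ hm0
  have hle3 : (L % m) * D1 ≤ D2 := le_trans (Nat.mul_le_mul_right _ hr.le) h3
  obtain ⟨z, hz⟩ := exists_add_of_le hle3
  have hdiv : (pqFib p q a) ∣ z := by
    have e1 : z + q ^ d * (pqFib p q a * c) = (L / m) * (m * D1) := by
      have := Nat.mod_add_div L m
      rw [← hc]
      have e2 : L * D1 = (L % m) * D1 + (L / m) * (m * D1) := by
        conv_lhs => rw [← this]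
        ring
      omega
    have e3 : m * D1 = pqFib p q a * b := by rw [hb, hm]; ring
    have e4 : pqFib p q a ∣ q ^ d * (pqFib p q a * c) := ⟨q ^ d * c, by ring⟩
    rw [← Nat.dvd_add_left e4, e1, e3]
    exact ⟨L / m * b, by ring⟩
  obtain ⟨x, hx⟩ := hdiv
  exact ⟨x, L % m, by rw [hz, hx]; ring⟩

omit hp hq in
lemma relA16 (S d1 Dj : ℕ) (hd1 : 0 < d1) (hDj : 0 < Dj) (hS : Nat.gcd d1 Dj ∣ S) (hS0 : 0 < S)
    (hmin : ∀ B α, 0 < B → B * Dj = α * d1 + S → Nat.lcm d1 Dj ≤ B * Dj) :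
    ∃ x y, 0 < y ∧ S = x * Dj + y * d1 := by
  have hex : ∃ A B : ℕ, S + A * d1 = B * Dj := by
    obtain ⟨c, hc⟩ := hS
    have hbez := Nat.gcd_eq_gcd_ab d1 Dj
    generalize Nat.gcdA d1 Dj = x0 at hbez
    generalize Nat.gcdB d1 Dj = y0 at hbez
    have e1 : (S : ℤ) = c * (d1 * x0 + Dj * y0) := by
      rw [← hbez, hc]; push_cast; ring
    obtain ⟨K, hK⟩ : ∃ K : ℕ, K = ((c : ℤ) * x0).natAbs + ((c : ℤ) * y0).natAbs := ⟨_, rfl⟩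
    generalize hu : (c : ℤ) * x0 = u at hK
    generalize hv : (c : ℤ) * y0 = v at hK
    have k0 : K ≤ K * Dj := Nat.le_mul_of_pos_right _ hDj
    have k0' : K ≤ K * d1 := Nat.le_mul_of_pos_right _ hd1
    zify at k0 k0'
    have k1 : (0:ℤ) ≤ K * Dj - u := by omega
    have k2 : (0:ℤ) ≤ K * d1 + v := by omega
    refine ⟨(K * Dj - u : ℤ).toNat, (K * d1 + v : ℤ).toNat, ?_⟩
    zify
    rw [Int.toNat_of_nonneg k1, Int.toNat_of_nonneg k2, e1, ← hu, ← hv]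
    ring
  obtain ⟨A, ⟨B, hB⟩, hfmin⟩ : ∃ A, (∃ B, S + A * d1 = B * Dj) ∧
      ∀ A' < A, ¬ ∃ B, S + A' * d1 = B * Dj := by
    classical
    exact ⟨Nat.find hex, Nat.find_spec hex, fun A' h => Nat.find_min hex h⟩
  have hB0 : 0 < B := by
    rcases Nat.eq_zero_or_pos B with h0 | h0
    · rw [h0] at hB; omega
    · exact h0
  have hl := hmin B A hB0 (by rw [← hB]; ring)
  obtain ⟨m1, hm1⟩ := Nat.dvd_lcm_left d1 Dj
  obtain ⟨m3, hm3⟩ := Nat.dvd_lcm_right d1 Dj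
  have hm1pos : 0 < m1 := by
    have := Nat.lcm_pos hd1 hDj
    rcases Nat.eq_zero_or_pos m1 with h0 | h0
    · rw [h0] at hm1; omega
    · exact h0
  have hBm : m3 ≤ B := by
    rw [hm3, mul_comm] at hl
    exact Nat.le_of_mul_le_mul_right hl hDj
  have heq : m1 * d1 = m3 * Dj := by rw [mul_comm, ← hm1, hm3, mul_comm]
  obtain ⟨x, hx⟩ := exists_add_of_le hBm
  rw [hx, add_mul] at hB
  have hAm : A < m1 := by
    by_contra hc
    push Not at hc
    obtain ⟨A', hA'⟩ := exists_add_of_le hc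
    refine hfmin A' (by omega) ⟨x, ?_⟩
    rw [hA', add_mul] at hB
    omega
  obtain ⟨yy, hyy⟩ := exists_add_of_le hAm.le
  refine ⟨x, yy, by omega, ?_⟩
  rw [hyy, add_mul] at heq
  omega

/-- pair (0,j) -/
lemma pair0j16 (hpq : Nat.gcd p q = 1) (h a d j : ℕ) (ha2 : 2 ≤ pqFib p q a) (hd : 0 < d)
    (hh : 0 < h) (hj : 2 ≤ j) (hnj : ¬ pqFib p q a ∣ pqFib p q (h * a + j * d))
    (hmin : ∀ B α β : ℕ, 0 < B →
      B * pqFib p q (h * a + j * d) = α * pqFib p q a + β * pqFib p q (h * a + d) →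
      Nat.lcm (pqFib p q a) (pqFib p q (h * a + j * d)) ≤ B * pqFib p q (h * a + j * d)) :
    j * d ∣ a := by
  have ha : 0 < a := by
    rcases Nat.eq_zero_or_pos a with h0 | h0
    · subst h0; simp [f0_16] at ha2
    · exact h0
  have hg1 : Nat.gcd (pqFib p q a) (pqFib p q (h * a + d)) = pqFib p q (Nat.gcd a d) := by
    rw [fgcd16 hpq]; congr 1; simp
  have hgj : Nat.gcd (pqFib p q a) (pqFib p q (h * a + j * d)) = pqFib p q (Nat.gcd a (j * d)) := by
    rw [fgcd16 hpq]; congr 1; simp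
  have hD1 := fpos16 hp hq (h * a + d) (by omega)
  have hDj := fpos16 hp hq (h * a + j * d) (by positivity)
  have hy := fpos16 hp hq (Nat.gcd a d) (Nat.gcd_pos_of_pos_left _ ha)
  have hgpos : 0 < Nat.gcd a (j * d) := Nat.gcd_pos_of_pos_left _ ha
  have hep := fpos16 hp hq (Nat.gcd a (j * d)) hgpos
  have hyle : pqFib p q (Nat.gcd a d) ∣ pqFib p q (Nat.gcd a (j * d)) :=
    fdvd16' (Nat.gcd_dvd_gcd_mul_left_right _ _ _)
  obtain ⟨s, hs⟩ := hyle
  obtain ⟨b, hb⟩ : pqFib p q (Nat.gcd a d) ∣ pqFib p q (h * a + d) := by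
    rw [← hg1]; exact Nat.gcd_dvd_right _ _
  obtain ⟨m, hm⟩ : pqFib p q (Nat.gcd a d) ∣ pqFib p q a := fdvd16' (Nat.gcd_dvd_left _ _)
  have hea : Nat.gcd a (j * d) ∣ a := Nat.gcd_dvd_left _ _
  have hej : Nat.gcd a (j * d) ∣ j * d := Nat.gcd_dvd_right _ _
  set e := Nat.gcd a (j * d)
  set y := Nat.gcd a d
  set d1 := pqFib p q a with hd1def
  set D1 := pqFib p q (h * a + d) with hD1def
  set Dj := pqFib p q (h * a + j * d) with hDjdef
  have hs0 : 0 < s := by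
    rcases Nat.eq_zero_or_pos s with h0 | h0
    · rw [h0] at hs; omega
    · exact h0
  obtain ⟨x, yy, hyy0, hrel⟩ := relA16 (s * D1) d1 Dj (by omega) hDj
    (by rw [hgj]; exact ⟨b, by rw [hs, hb]; ring⟩) (Nat.mul_pos hs0 hD1)
    (fun B α hB h1 => hmin B α s hB h1)
  rcases Nat.eq_zero_or_pos x with hx0 | hx0
  · exfalso
    rw [hx0, zero_mul, zero_add] at hrel
    have hcop : Nat.Coprime m b := by
      have h1 : Nat.gcd (pqFib p q y * m) (pqFib p q y * b) = pqFib p q y := by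
        rw [← hm, ← hb]; exact hg1
      rw [Nat.gcd_mul_left] at h1
      exact Nat.eq_of_mul_eq_mul_left hy (by rw [mul_one]; exact h1)
    have h2 : m ∣ s * b := by
      refine ⟨yy, ?_⟩
      rw [hb, hm] at hrel
      apply Nat.eq_of_mul_eq_mul_left hy
      linarith [hrel]
    have h3 : m ∣ s := hcop.dvd_of_dvd_mul_right h2
    have h4 : d1 ∣ pqFib p q e := by rw [hm, hs]; exact Nat.mul_dvd_mul_left _ h3
    have h5 := Nat.le_of_dvd hep h4
    have h6 : e = a := by
      by_contra hne
      have hlt : e < a := lt_of_le_of_ne (Nat.le_of_dvd ha hea) hne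
      have := flt16' hp hq hlt ha2
      omega
    apply hnj
    apply fdvd16'
    rw [h6] at hej
    exact dvd_add (Dvd.intro_left _ rfl) hej
  · have h1 : Dj < s * D1 := by
      have := Nat.mul_pos hyy0 (show 0 < d1 by omega)
      have h7 : Dj ≤ x * Dj := Nat.le_mul_of_pos_left _ hx0
      omega
    have h2 := fge16 (p := p) (q := q) (h * a + d) ((j - 1) * d)
    have h3 : h * a + d + (j - 1) * d = h * a + j * d := by
      obtain ⟨j', rfl⟩ : ∃ j', j = j' + 1 := ⟨j - 1, by omega⟩
      rw [Nat.add_sub_cancel]; ring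
    rw [h3] at h2
    have h4 : pqFib p q ((j - 1) * d + 1) < s := by
      apply Nat.lt_of_mul_lt_mul_right (a := D1)
      exact lt_of_le_of_lt h2 h1
    have h5 : pqFib p q ((j - 1) * d + 1) < pqFib p q e := by
      rw [hs]; exact lt_of_lt_of_le h4 (Nat.le_mul_of_pos_left _ hy)
    have h6 : (j - 1) * d + 1 < e := by
      by_contra hc
      push Not at hc
      have := fmono16 hp hq hc
      omega
    obtain ⟨c, hc⟩ := hej
    have hc1 : c = 1 := by
      have hjd : 0 < j * d := by positivity
      rcases Nat.lt_or_ge c 2 with h7 | h7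
      · rcases Nat.eq_zero_or_pos c with h8 | h8
        · rw [h8] at hc; omega
        · omega
      · exfalso
        have h8 : e * 2 ≤ j * d := by rw [hc]; exact Nat.mul_le_mul_left _ h7
        have h9 : j * d = (j - 1) * d + d := by
          have : j = (j - 1) + 1 := by omega
          calc j * d = ((j - 1) + 1) * d := by rw [← this]
            _ = _ := by ring
        have h10 : d ≤ (j - 1) * d := Nat.le_mul_of_pos_left _ (by omega)
        generalize (j - 1) * d = z at *
        omega
    rw [hc, hc1, mul_one]
    exact hea

/-- pair (i,l), `1 ≤ i < l` -/
lemma pairij16 (hpq : Nat.gcd p q = 1) (h a d i l : ℕ) (hd2 : 2 ≤ d) (hi : 1 ≤ i) (hil : i < l)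
    (ha : 0 < a) (hh : 0 < h)
    (hle : Nat.lcm (pqFib p q (h * a + i * d)) (pqFib p q (h * a + l * d)) ≤
      L16 p q d * pqFib p q (h * a + i * d)) : False := by
  have hDi := fpos16 hp hq (h * a + i * d) (by positivity)
  have hmul := Nat.gcd_mul_lcm (pqFib p q (h * a + i * d)) (pqFib p q (h * a + l * d))
  rw [fgcd16 hpq] at hmul
  obtain ⟨c, rfl⟩ : ∃ c, l = i + c := exists_add_of_le hil.le
  have hc0 : 0 < c := by omega
  set g := Nat.gcd (h * a + i * d) (h * a + (i + c) * d) with hgdef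
  have hg : g ∣ c * d := by
    have h1 : g ∣ h * a + i * d := Nat.gcd_dvd_left _ _
    have h2 : g ∣ h * a + (i + c) * d := Nat.gcd_dvd_right _ _
    rw [show h * a + (i + c) * d = h * a + i * d + c * d by ring] at h2
    exact (Nat.dvd_add_right h1).1 h2
  have hcd : 2 ≤ c * d := by nlinarith
  have h1 : pqFib p q g ≤ pqFib p q (c * d) := fmono16 hp hq (Nat.le_of_dvd (by omega) hg)
  have h2 := La16 hp hq (c * d) d (by omega) hcd
  have h3 : pqFib p q (c * d + d + 1) ≤ pqFib p q (h * a + (i + c) * d) := by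
    apply fmono16 hp hq
    have : 0 < h * a := by positivity
    nlinarith
  have h4 := Nat.mul_le_mul_left (pqFib p q g) hle
  rw [hmul] at h4
  have h5 : pqFib p q (h * a + (i + c) * d) ≤ L16 p q d * pqFib p q g := by
    refine le_of_mul_le_mul_left (a := pqFib p q (h * a + i * d)) ?_ hDi
    linarith
  have h6 := Nat.mul_le_mul_left (L16 p q d) h1
  omega

end fib16
lemma isoA16 (α β L f3 d1 D1 D2 D3 v0 v1 v2 v3 : ℕ) (h : α + β * L = f3) (hα : α < L)
    (hα0 : 0 < α) (hL : D2 < L * D1) (hS : v1 + v2 * L + v3 * f3 = f3) (hd1 : 0 < d1)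
    (hw : v0 * d1 + v1 * D1 + v2 * D2 + v3 * D3 = α * D1 + β * D2) (hv : v1 ≠ 0 ∨ v2 ≠ 0) :
    v0 = 0 ∧ v1 = α ∧ v2 = β ∧ v3 = 0 := by
  have hv3 : v3 = 0 := by
    rcases Nat.eq_zero_or_pos v3 with h0 | h0
    · exact h0
    · exfalso
      have h1 : f3 ≤ v3 * f3 := Nat.le_mul_of_pos_left _ h0
      rcases hv with h2 | h2
      · omega
      · have : 0 < v2 * L := Nat.mul_pos (by omega) (by omega)
        omega
  subst hv3
  simp only [zero_mul, add_zero] at hS hw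
  rcases lt_trichotomy v2 β with h1 | h1 | h1
  · exfalso
    obtain ⟨c, hc, rfl⟩ : ∃ c, 0 < c ∧ β = v2 + c := ⟨β - v2, by omega, by omega⟩
    rw [add_mul] at h hw
    have h2 : v1 = α + c * L := by omega
    rw [h2, add_mul] at hw
    have h3 := Nat.mul_lt_mul_of_pos_left hL hc
    rw [← mul_assoc] at h3
    omega
  · subst h1
    have h2 : v1 = α := by omega
    subst h2
    have h3 : v0 * d1 = 0 := by omega
    rcases Nat.mul_eq_zero.1 h3 with h4 | h4
    · exact ⟨h4, rfl, rfl, rfl⟩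
    · omega
  · exfalso
    obtain ⟨c, hc, rfl⟩ : ∃ c, 0 < c ∧ v2 = β + c := ⟨v2 - β, by omega, by omega⟩
    rw [add_mul] at hS
    have : L ≤ c * L := Nat.le_mul_of_pos_left _ hc
    omega

set_option maxHeartbeats 1000000 in
lemma isoB16 {p q : ℕ} (hp : 0 < p) (hq : 0 < q) (hpq : Nat.gcd p q = 1) (h a d : ℕ)
    (hh : 0 < h) (hd2 : 2 ≤ d) (he : Even d) (hda : d ∣ a) (ha6 : 6 * d ≤ a) :
    ∃ α β t : ℕ, 0 < α ∧ 0 < β ∧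
      α * pqFib p q (h * a + 1 * d) + β * pqFib p q (h * a + 2 * d) =
        pqFib p q (h * a + 3 * d) + (t + 1) * q ^ d * pqFib p q (h * a) ∧
      α * pqFib p q (h * a + 1 * d) + β * pqFib p q (h * a + 2 * d) < pqFib p q (h * a + 4 * d) ∧
      ∀ v0 v1 v2 v3 : ℕ, v0 * pqFib p q a + v1 * pqFib p q (h * a + 1 * d)
        + v2 * pqFib p q (h * a + 2 * d) + v3 * pqFib p q (h * a + 3 * d) =
        α * pqFib p q (h * a + 1 * d) + β * pqFib p q (h * a + 2 * d) → (v1 ≠ 0 ∨ v2 ≠ 0) →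
        v0 = 0 ∧ v1 = α ∧ v2 = β ∧ v3 = 0 := by
  have hd : 0 < d := by omega
  have ha : 0 < a := by omega
  have hL3 := Ld16 hp hq d hd2
  have hLf := Lf16 hp hq d hd2 he
  have hLe := Le16 hp hq hpq d
  have hLc := Lc16 hp hq d hd
  have hLb := Lb16 hp hq d hd2
  have e2 := flucE16 (p := p) (q := q) d hd he (h * a)
  have e3 := flucE16 (p := p) (q := q) d hd he (h * a + d)
  have g1 := fge16 (p := p) (q := q) (h * a + 1 * d) d
  have g2 := fge16 (p := p) (q := q) (h * a + 2 * d) d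
  have g4 := fge16 (p := p) (q := q) (h * a + 2 * d) (2 * d)
  have hfd := fpos16 hp hq d hd
  have hd1 := fpos16 hp hq a ha
  have h2d := f2d16 (p := p) (q := q) d hd
  have h3d := f3d16 hp hq d hd he
  have k1 := fge16 (p := p) (q := q) (2 * d) (2 * d)
  have k2 := fge16 (p := p) (q := q) (2 * d + 2 * d) (2 * d)
  have k3 : pqFib p q (2 * d + 2 * d + 2 * d) ≤ pqFib p q a := fmono16 hp hq (by omega)
  have m1 := fadd16 p q (h * a) (1 * d - 1)
  have m2 := fadd16 p q (h * a) (2 * d - 1)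
  have m3 := fadd16 p q (h * a) (3 * d - 1)
  have hD0 := fpos16 hp hq (h * a) (by positivity)
  have hD1 := fpos16 hp hq (h * a + 1 * d) (by positivity)
  have hu : Nat.Coprime (pqFib p q (h * a + 1)) (pqFib p q a) :=
    (fcops16 hpq (h * a)).coprime_dvd_right (fdvd16' (Dvd.intro_left _ rfl))
  obtain ⟨N, hN⟩ : pqFib p q d ∣ pqFib p q a := fdvd16' hda
  obtain ⟨c0, hc0⟩ : pqFib p q a ∣ pqFib p q (h * a) := fdvd16' (Dvd.intro_left _ rfl)
  rw [show h * a + (1 * d - 1) + 1 = h * a + 1 * d by omega, show 1 * d - 1 + 1 = d by omega] at m1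
  rw [show h * a + (2 * d - 1) + 1 = h * a + 2 * d by omega, show 2 * d - 1 + 1 = 2 * d by omega,
    h2d] at m2
  rw [show h * a + (3 * d - 1) + 1 = h * a + 3 * d by omega, show 3 * d - 1 + 1 = 3 * d by omega] at m3
  rw [show h * a + 1 * d + d = h * a + 2 * d by ring] at g1
  rw [show h * a + 2 * d + d = h * a + 3 * d by ring] at g2
  rw [show h * a + 2 * d + 2 * d = h * a + 4 * d by ring] at g4
  rw [show h * a + d = h * a + 1 * d by ring] at e2
  rw [show h * a + d + 2 * d = h * a + 3 * d by ring, show h * a + d + d = h * a + 2 * d by ring,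
    show h * a + d = h * a + 1 * d by ring] at e3
  rw [h2d] at k1
  generalize pqFib p q (1 * d - 1) = z1 at *
  generalize pqFib p q (2 * d - 1) = z2 at *
  generalize pqFib p q (3 * d - 1) = z3 at *
  generalize pqFib p q (h * a + 1 * d) = D1 at *
  generalize pqFib p q (h * a + 2 * d) = D2 at *
  generalize pqFib p q (h * a + 3 * d) = D3 at *
  generalize pqFib p q (h * a + 4 * d) = D4 at *
  generalize pqFib p q (h * a + 1) = u at *
  generalize pqFib p q (h * a) = D0 at *
  generalize pqFib p q (2 * d + 2 * d + 2 * d) = F6 at *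
  generalize pqFib p q (2 * d + 2 * d) = F4 at *
  generalize pqFib p q (2 * d + 1) = G2 at *
  generalize pqFib p q (d + 1) = G1 at *
  generalize pqFib p q (3 * d) = F3 at *
  generalize pqFib p q a = d1 at *
  generalize pqFib p q d = Fd at *
  have hLQ : ¬ L16 p q d ∣ q ^ d := by
    intro hdv
    have := Nat.Coprime.eq_one_of_dvd (hLe.pow_right d) hdv
    omega
  have hQpos : 0 < q ^ d := by positivity
  generalize L16 p q d = L at *
  generalize q ^ d = Q at *
  clear h2d hLe
  have hQ := Nat.mod_add_div Q L
  have hr : Q % L < L := Nat.mod_lt _ (by omega)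
  have hr0 : 0 < Q % L := Nat.pos_of_ne_zero (fun h0 => hLQ (Nat.dvd_of_mod_eq_zero h0))
  generalize Q % L = r at *
  generalize Q / L = t at *
  have ht : t + 1 < L := by
    by_contra hc
    push Not at hc
    have : L * (L - 1) ≤ L * t := Nat.mul_le_mul_left _ (by omega)
    rw [Nat.mul_sub] at this
    have : L * 1 ≤ L * L := Nat.mul_le_mul_left _ (by omega)
    omega
  obtain ⟨α, hα⟩ : ∃ α, L = r + α := ⟨L - r, by omega⟩
  obtain ⟨β, hβ⟩ : ∃ β, L = t + 1 + β := ⟨L - (t + 1), by omega⟩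
  have hα0 : 0 < α := by omega
  have hβ0 : 0 < β := by omega
  -- size facts
  have s1 : L * D1 ≤ 2 * D2 := by
    calc L * D1 ≤ 2 * G1 * D1 := Nat.mul_le_mul_right _ hLc
      _ = 2 * (G1 * D1) := by ring
      _ ≤ _ := Nat.mul_le_mul_left _ g1
  have s2 : L * L * D1 ≤ 4 * D3 := by
    calc L * L * D1 = L * (L * D1) := by ring
      _ ≤ 2 * G1 * (2 * D2) := Nat.mul_le_mul hLc s1
      _ = 4 * (G1 * D2) := by ring
      _ ≤ _ := Nat.mul_le_mul_left _ g2
  have s3 : D2 < L * D1 := by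
    have := Nat.mul_pos hQpos hD0
    omega
  obtain ⟨f3, hf3⟩ : ∃ f3, L * L = Q + f3 := ⟨L * L - Q, by omega⟩
  have hab : α + β * L = f3 := by
    zify at hf3 hQ hα hβ ⊢
    linear_combination hf3 - hQ - hα - L * hβ
  have hF3 : F3 = f3 * Fd := by
    have : L * (L * Fd) = Q * Fd + f3 * Fd := by rw [← mul_assoc, hf3]; ring
    omega
  have hNbig : (L + 2) * (L + 2) * L ≤ N := by
    have : (L + 2) * ((L + 2) * (L * Fd)) ≤ Fd * N := by
      calc _ ≤ G2 * (G2 * (L * Fd)) := Nat.mul_le_mul hLb (Nat.mul_le_mul_right _ hLb)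
        _ ≤ G2 * F4 := Nat.mul_le_mul_left _ k1
        _ ≤ _ := by omega
    refine le_of_mul_le_mul_left (a := Fd) ?_ hfd
    linarith
  have hN4 : 4 * (L * L) < N := by
    have e5 : (L + 2) * (L + 2) * L = L * L * L + 4 * (L * L) + 4 * L := by ring
    omega
  refine ⟨α, β, t, hα0, hβ0, ?_, ?_, ?_⟩
  · zify at hα hβ e2 e3 hQ ⊢
    linear_combination (-D1 : ℤ) * hα - D2 * hβ - (t + 1) * e2 - e3 - D1 * hQ
  · have a1 : α * D1 ≤ L * D1 := Nat.mul_le_mul_right _ (by omega)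
    have a2 : (β + 1) * D2 ≤ L * D2 := Nat.mul_le_mul_right _ (by omega)
    have a3 : (L + 2) * D2 ≤ G2 * D2 := Nat.mul_le_mul_right _ hLb
    have a4 : 0 < D2 := by
      have : 0 < L * D1 := by positivity
      omega
    rw [add_mul] at a2 a3
    omega
  · intro v0 v1 v2 v3 hw hv
    refine isoA16 α β L f3 d1 D1 D2 D3 v0 v1 v2 v3 hab (by omega) hα0 s3 ?_ hd1 hw hv
    have hdeg : α * D1 + β * D2 ≤ L * L * D1 := by
      have a1 : α * D1 ≤ L * D1 := Nat.mul_le_mul_right _ (by omega)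
      have a2 : β * D2 ≤ β * (L * D1) := Nat.mul_le_mul_left _ s3.le
      have a3 : (β + 1) * (L * D1) ≤ L * (L * D1) := Nat.mul_le_mul_right _ (by omega)
      rw [add_mul, ← mul_assoc L] at a3
      omega
    have hSle : v1 + v2 * L + v3 * f3 ≤ 4 * (L * L) := by
      refine le_of_mul_le_mul_right (a := D1) ?_ hD1
      have b2 : v2 * (L * D1) ≤ v2 * (2 * D2) := Nat.mul_le_mul_left _ s1
      have b3 : v3 * (f3 * D1) ≤ v3 * (4 * D3) := by
        apply Nat.mul_le_mul_left
        exact le_trans (Nat.mul_le_mul_right _ (by omega)) s2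
      calc (v1 + v2 * L + v3 * f3) * D1 = v1 * D1 + v2 * (L * D1) + v3 * (f3 * D1) := by ring
        _ ≤ 4 * (v0 * d1 + v1 * D1 + v2 * D2 + v3 * D3) := by
          have c2 : v2 * (2 * D2) = 2 * (v2 * D2) := by ring
          have c3 : v3 * (4 * D3) = 4 * (v3 * D3) := by ring
          omega
        _ ≤ 4 * (L * L * D1) := by rw [hw]; exact Nat.mul_le_mul_left _ hdeg
        _ = _ := by ring
    have hcong : (N : ℤ) ∣ (v1 + v2 * L + v3 * f3 : ℕ) - (f3 : ℕ) := by
      have hcop : IsCoprime (N : ℤ) (u : ℤ) := by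
        have : Nat.Coprime N u := by
          rw [hN] at hu
          exact (hu.coprime_dvd_right (Dvd.intro_left _ rfl)).symm
        exact this.isCoprime
      apply hcop.dvd_of_dvd_mul_left
      have hfz : (Fd : ℤ) ≠ 0 := by exact_mod_cast hfd.ne'
      apply (mul_dvd_mul_iff_left hfz).1
      have hNz : (d1 : ℤ) = Fd * N := by exact_mod_cast hN
      rw [← hNz]
      refine ⟨-(v0 : ℤ) + (α - v1) * (q * c0 * z1) + (β - v2) * (q * c0 * z2)
        - v3 * (q * c0 * z3), ?_⟩
      zify at m1 m2 m3 hF3 hab hc0 hw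
      rw [hF3] at m3
      rw [hc0] at m1 m2 m3
      rw [m1, m2, m3] at hw
      push_cast
      linear_combination hw + u * Fd * hab
    have hz := Int.eq_zero_of_abs_lt_dvd hcong (by
      rw [abs_lt]; constructor <;> omega)
    omega
structure Ctx16 (p q h a d n : ℕ) (A : Fin n → ℕ) : Prop where
  hp : 0 < p
  hq : 0 < q
  hpq : Nat.gcd p q = 1
  hh : 0 < h
  ha : 0 < a
  hd2 : 2 ≤ d
  he : Even d
  hn : 3 ≤ n
  hA0 : ∀ i : Fin n, (i : ℕ) = 0 → A i = pqFib p q a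
  hA1 : ∀ i : Fin n, (i : ℕ) ≠ 0 → A i = pqFib p q (h * a + (i : ℕ) * d)
  hd3 : ¬ ∃ α β : ℕ, pqFib p q (h * a + 2 * d) =
    α * pqFib p q a + β * pqFib p q (h * a + 1 * d)

section ctx16
variable {p q h a d n : ℕ} {A : Fin n → ℕ} (C : Ctx16 p q h a d n A)
include C

lemma c1_16 : 2 ≤ pqFib p q a := by
  have h1 := fpos16 C.hp C.hq a C.ha
  by_contra hc
  have h2 : pqFib p q a = 1 := by omega
  exact C.hd3 ⟨pqFib p q (h * a + 2 * d), 0, by rw [h2]; ring⟩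

lemma c2_16 : ¬ a ∣ 2 * d := by
  intro hc
  obtain ⟨c, hc⟩ : pqFib p q a ∣ pqFib p q (h * a + 2 * d) :=
    fdvd16' (dvd_add (Dvd.intro_left _ rfl) hc)
  exact C.hd3 ⟨c, 0, by rw [hc]; ring⟩

lemma dva16 (x : ℕ) (hx : pqFib p q a ∣ pqFib p q (h * a + x)) : a ∣ x := by
  have h1 := Nat.gcd_eq_left hx
  rw [fgcd16 C.hpq, show Nat.gcd a (h * a + x) = Nat.gcd a x by simp] at h1
  have h2 : Nat.gcd a x ∣ a := Nat.gcd_dvd_left _ _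
  rcases lt_or_eq_of_le (Nat.le_of_dvd C.ha h2) with h3 | h3
  · have := flt16' C.hp C.hq h3 (c1_16 C)
    omega
  · rw [← h3]; exact Nat.gcd_dvd_right _ _

lemma Apos16 (i : Fin n) : 0 < A i := by
  by_cases hi : (i : ℕ) = 0
  · rw [C.hA0 i hi]; exact fpos16 C.hp C.hq a C.ha
  · rw [C.hA1 i hi]; apply fpos16 C.hp C.hq
    have := Nat.mul_pos C.hh C.ha
    omega

lemma Alt16 (i j : Fin n) (hij : (i : ℕ) < j) : A i < A j := by
  have hj : (j : ℕ) ≠ 0 := by omega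
  have hd2 := C.hd2
  have hha := Nat.mul_pos C.hh C.ha
  have h1 : 1 * d ≤ j * d := Nat.mul_le_mul_right _ (by omega)
  rw [C.hA1 j hj]
  by_cases hi : (i : ℕ) = 0
  · rw [C.hA0 i hi]
    apply flt16 C.hp C.hq
    · have : a ≤ h * a := Nat.le_mul_of_pos_left _ C.hh
      omega
    · omega
  · rw [C.hA1 i hi]
    apply flt16 C.hp C.hq
    · have := Nat.mul_lt_mul_of_pos_right hij (show 0 < d by omega)
      omega
    · omega

lemma Andvd16 (i j : Fin n) (hij : (i : ℕ) < j) : ¬ A j ∣ A i := fun hc => by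
  have h1 := Nat.le_of_dvd (Apos16 C i) hc
  have h2 := Alt16 C i j hij
  omega

lemma Ainj16 : Function.Injective A := by
  intro i j hij
  rcases lt_trichotomy (i : ℕ) j with h1 | h1 | h1
  · have := Alt16 C i j h1; omega
  · exact Fin.ext h1
  · have := Alt16 C j i h1; omega

lemma And01_16 (i j : Fin n) (hi : (i : ℕ) = 0) (hj : (j : ℕ) = 1) : ¬ A i ∣ A j := by
  rw [C.hA0 i hi, C.hA1 j (by omega), hj]
  intro hc
  have := dva16 C _ hc
  exact c2_16 C (by rw [one_mul] at this; exact Dvd.dvd.mul_left this 2)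

lemma Ands16 (i j : Fin n) (hi : (i : ℕ) ≠ 0) (hj : (j : ℕ) = i + 1) : ¬ A i ∣ A j := by
  rw [C.hA1 i hi, C.hA1 j (by omega), hj]
  intro hc
  have h1 := Nat.gcd_eq_left hc
  rw [fgcd16 C.hpq] at h1
  have hd2 := C.hd2
  have hha := Nat.mul_pos C.hh C.ha
  have h3 : 1 * d ≤ i * d := Nat.mul_le_mul_right _ (by omega)
  set g := Nat.gcd (h * a + i * d) (h * a + (i + 1) * d) with hg
  have h2 : g ∣ d := by
    have h4 : g ∣ h * a + i * d := Nat.gcd_dvd_left _ _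
    have h5 : g ∣ h * a + (i + 1) * d := Nat.gcd_dvd_right _ _
    rw [show h * a + (i + 1) * d = h * a + i * d + d by ring] at h5
    exact (Nat.dvd_add_right h4).1 h5
  have h4 := Nat.le_of_dvd (by omega) h2
  have := flt16 C.hp C.hq (m := g) (n := h * a + i * d) (by omega) (by omega)
  omega

lemma And_16 (i : Fin n) : ∃ l, ¬ A i ∣ A l := by
  have hn := C.hn
  by_cases hi : (i : ℕ) = 0
  · exact ⟨⟨1, by omega⟩, And01_16 C _ _ hi rfl⟩
  · exact ⟨⟨0, by omega⟩, Andvd16 C _ _ (by simpa using Nat.pos_of_ne_zero hi)⟩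

omit C in
lemma Tm2_16 (A : Fin n → ℕ) (i x y : Fin n) (c cx cy : ℕ) (hx : ¬ A i ∣ A x) (hy : ¬ A i ∣ A y)
    (hw : cx * A x + cy * A y = c * A i) : Tm16 A i c := by
  classical
  refine ⟨Finsupp.single x cx + Finsupp.single y cy, ?_, ?_⟩
  · intro l hl
    rw [Finsupp.add_apply, Finsupp.single_apply, Finsupp.single_apply,
      if_neg (by rintro rfl; exact hx hl), if_neg (by rintro rfl; exact hy hl), add_zero]
  · rw [wt16_add, wt16_single, wt16_single, hw]

lemma TmL16 (i : Fin n) (hi : (i : ℕ) ≠ 0) (hin : (i : ℕ) + 1 < n) : Tm16 A i (L16 p q d) := by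
  have hd2 := C.hd2
  have e := flucE16 (p := p) (q := q) d (by omega) C.he (h * a + (i - 1) * d)
  have hi1 : (i : ℕ) = (i - 1) + 1 := by omega
  have x1 : h * a + (i - 1) * d + d = h * a + i * d := by
    conv_rhs => rw [hi1]
    ring
  have x2 : h * a + (i - 1) * d + 2 * d = h * a + (i + 1) * d := by
    conv_rhs => rw [hi1]
    ring
  rw [x1, x2] at e
  have s1 := Ands16 C i ⟨i + 1, hin⟩ hi rfl
  by_cases h1 : (i : ℕ) = 1
  · obtain ⟨c, hc⟩ : pqFib p q a ∣ pqFib p q (h * a) := fdvd16' (Dvd.intro_left _ rfl)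
    refine Tm2_16 A i ⟨i + 1, hin⟩ ⟨0, by omega⟩ _ 1 (q ^ d * c) s1
      (Andvd16 C _ _ (by simp; omega)) ?_
    rw [C.hA1 i hi, C.hA1 ⟨i + 1, hin⟩ (by simp), C.hA0 ⟨0, by omega⟩ rfl, ← e]
    rw [show h * a + (i - 1) * d = h * a by rw [h1]; simp, hc]; ring
  · refine Tm2_16 A i ⟨i + 1, hin⟩ ⟨i - 1, by omega⟩ _ 1 (q ^ d) s1
      (Andvd16 C _ _ (by simp; omega)) ?_
    rw [C.hA1 i hi, C.hA1 ⟨i + 1, hin⟩ (by simp), C.hA1 ⟨i - 1, by omega⟩ (by simp; omega), ← e]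
    ring

lemma Red0_16 (i j : Fin n) (hi : (i : ℕ) = 0) (hj : (j : ℕ) ≠ 0) (hr : ¬ Red16 A j) :
    ¬ A i ∣ A j := by
  rintro ⟨c, hc⟩
  apply hr
  refine ⟨Finsupp.single i c, ?_, ?_⟩
  · classical
    rw [Finsupp.single_apply, if_neg]
    rintro rfl; exact hj hi
  · rw [wt16_single, hc, mul_comm]

lemma pair1_16 (i j : Fin n) (hi : (i : ℕ) ≠ 0) (hij : (i : ℕ) < j) (M : ℕ) (hM : 0 < M)
    (h1 : A i ∣ M) (h2 : A j ∣ M) (hT : ∀ c, 0 < c → Tm16 A i c → M ≤ c * A i) : False := by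
  have hd2 := C.hd2
  have hL := Ld16 C.hp C.hq d hd2
  have h3 := hT _ (by omega) (TmL16 C i hi (by have := j.2; omega))
  have h4 := le_trans (Nat.le_of_dvd hM (Nat.lcm_dvd h1 h2)) h3
  rw [C.hA1 i hi, C.hA1 j (by omega)] at h4
  exact pairij16 C.hp C.hq C.hpq h a d i j hd2 (by omega) hij C.ha C.hh h4

lemma pair_16 (i j : Fin n) (hij : (i : ℕ) < j) (hr : ¬ Red16 A j) (M : ℕ) (hM : 0 < M)
    (h1 : A i ∣ M) (h2 : A j ∣ M) (hTi : ∀ c, 0 < c → Tm16 A i c → M ≤ c * A i)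
    (hTj : ∀ c, 0 < c → Tm16 A j c → M ≤ c * A j) :
    (i : ℕ) = 0 ∧ 2 ≤ (j : ℕ) ∧ j * d ∣ a ∧ a ≠ j * d ∧ (4 ≤ n → 3 ≤ (j : ℕ)) := by
  have hd2 := C.hd2
  have hn := C.hn
  have hL := Ld16 C.hp C.hq d hd2
  have hi : (i : ℕ) = 0 := by
    by_contra hc
    exact pair1_16 C i j hc hij M hM h1 h2 hTi
  have hj0 : (j : ℕ) ≠ 0 := by omega
  have hlcm : Nat.lcm (A i) (A j) ≤ M := Nat.le_of_dvd hM (Nat.lcm_dvd h1 h2)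
  have hd1 := Red0_16 C i j hi hj0 hr
  have hj2 : 2 ≤ (j : ℕ) := by
    by_contra hc
    have hj1 : (j : ℕ) = 1 := by omega
    have h3 := le_trans hlcm (hTj _ (by omega) (TmL16 C j hj0 (by omega)))
    rw [C.hA0 i hi, C.hA1 j hj0, hj1, one_mul] at h3
    obtain ⟨α, β, h4⟩ := pair01_16 C.hp C.hq C.hpq h a d C.ha (by omega) C.he C.hh (c2_16 C) h3
    exact C.hd3 ⟨α, β, by rw [one_mul]; exact h4⟩
  have hjd : j * d ∣ a := by
    refine pair0j16 C.hp C.hq C.hpq h a d j (c1_16 C) (by omega) C.hh hj2 ?_ ?_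
    · rw [C.hA0 i hi, C.hA1 j hj0] at hd1; exact hd1
    · intro B α β hB hw
      have h3 := hTj B hB (Tm2_16 A j i ⟨1, by omega⟩ B α β (Andvd16 C _ _ hij)
        (Andvd16 C _ _ (by simp; omega)) (by
          rw [C.hA0 i hi, C.hA1 j hj0, C.hA1 ⟨1, by omega⟩ (by simp), hw]; simp))
      have h4 := le_trans hlcm h3
      rw [C.hA0 i hi, C.hA1 j hj0] at h4
      exact h4
  have hne : a ≠ j * d := by
    intro hc
    apply hd1
    rw [C.hA0 i hi, C.hA1 j hj0]
    apply fdvd16'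
    rw [← hc]
    exact ⟨h + 1, by ring⟩
  refine ⟨hi, hj2, hjd, hne, ?_⟩
  intro hn4
  by_contra hc
  have hj : (j : ℕ) = 2 := by omega
  have h3 := le_trans hlcm (hTj _ (by omega) (TmL16 C j hj0 (by omega)))
  rw [C.hA0 i hi, C.hA1 j hj0, hj] at h3
  rw [hj] at hjd hne
  have hgcd : Nat.gcd (pqFib p q a) (pqFib p q (h * a + 2 * d)) = pqFib p q (2 * d) := by
    rw [fgcd16 C.hpq]; congr 1
    rw [show Nat.gcd a (h * a + 2 * d) = Nat.gcd a (2 * d) by simp]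
    exact Nat.gcd_eq_right hjd
  have hmul := Nat.gcd_mul_lcm (pqFib p q a) (pqFib p q (h * a + 2 * d))
  rw [hgcd] at hmul
  have h4 := Nat.mul_le_mul_left (pqFib p q (2 * d)) h3
  rw [hmul] at h4
  have hD2 := fpos16 C.hp C.hq (h * a + 2 * d) (by omega)
  have h5 : pqFib p q a ≤ L16 p q d * pqFib p q (2 * d) := by
    refine le_of_mul_le_mul_right (a := pqFib p q (h * a + 2 * d)) ?_ hD2
    linarith
  obtain ⟨c, hc⟩ := hjd
  have ha := C.ha
  have hc2 : 2 ≤ c := by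
    by_contra hlt
    rcases (show c = 0 ∨ c = 1 by omega) with h6 | h6
    · rw [h6] at hc; omega
    · rw [h6] at hc; omega
  have h6 : 2 * d * 2 ≤ a := by rw [hc]; exact Nat.mul_le_mul_left _ hc2
  have h7 : pqFib p q (2 * d + 2 * d) ≤ pqFib p q a := fmono16 C.hp C.hq (by omega)
  have h8 := fge16 (p := p) (q := q) (2 * d) (2 * d)
  have h9 := Nat.mul_le_mul_right (pqFib p q (2 * d)) (Lb16 C.hp C.hq d hd2)
  have h10 := fpos16 C.hp C.hq (2 * d) (by omega)
  rw [add_mul] at h9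
  omega

lemma critO16 (k : Type*) [Field k] (hCI : IsCI k A)
    (e : Fin n → Prop) (E W : Fin n →₀ ℕ) (he : ∀ i l, e i → e l → i = l)
    (hE : (∃ j, e j) → wt16 A E = wt16 A W ∧ W ≠ E ∧
      (∀ m', wt16 A m' = wt16 A E → (∃ l, E l ≠ 0 ∧ m' l ≠ 0) → m' = E) ∧
      (∀ i, ¬ Red16 A i → (∃ l, E l ≠ 0 ∧ ¬ A i ∣ A l) ∧ (∃ l, W l ≠ 0 ∧ ¬ A i ∣ A l)) ∧
      (∀ r, E ≠ Finsupp.single r 1 ∧ W ≠ Finsupp.single r 1)) :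
    ∃ i j : Fin n, (i : ℕ) < j ∧ ¬ e j ∧ ¬ Red16 A j ∧ ∃ M, 0 < M ∧ A i ∣ M ∧ A j ∣ M ∧
      (∀ c, 0 < c → Tm16 A i c → M ≤ c * A i) ∧ (∀ c, 0 < c → Tm16 A j c → M ≤ c * A j) := by
  have hn := C.hn
  obtain ⟨i, j, hij, hei, hej, hri, hrj, M, hM, h1, h2, h3, h4⟩ :=
    crit16 k (by omega) A (Apos16 C) (Ainj16 C) (And_16 C) hCI e E W he hE
  rcases lt_or_gt_of_ne (fun hc => hij (Fin.ext hc) : (i : ℕ) ≠ j) with hlt | hlt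
  · exact ⟨i, j, hlt, hej, hrj, M, hM, h1, h2, h3, h4⟩
  · exact ⟨j, i, hlt, hei, hri, M, hM, h2, h1, h4, h3⟩

lemma n4_16 (k : Type*) [Field k] (hCI : IsCI k A) (hn4 : 4 ≤ n) : False := by
  classical
  have hd2 := C.hd2
  obtain ⟨i, j, hij, -, hrj, M, hM, hiM, hjM, hTi, hTj⟩ :=
    critO16 C k hCI (fun _ => False) 0 0 (fun _ _ h => h.elim) (fun ⟨_, h⟩ => h.elim)
  obtain ⟨hi, hj2, hjd, hne, hj3⟩ := pair_16 C i j hij hrj M hM hiM hjM hTi hTj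
  have hj3 := hj3 hn4
  have ha := C.ha
  obtain ⟨c, hc⟩ := hjd
  have hc2 : 2 ≤ c := by
    by_contra hlt
    rcases (show c = 0 ∨ c = 1 by omega) with h6 | h6
    · rw [h6] at hc; omega
    · rw [h6] at hc; omega
  have ha6 : 6 * d ≤ a := by
    have h1 : 3 * d ≤ j * d := Nat.mul_le_mul_right _ hj3
    have h2 : j * d * 2 ≤ a := by rw [hc]; exact Nat.mul_le_mul_left _ hc2
    omega
  have hda : d ∣ a := ⟨j * c, by rw [hc]; ring⟩
  obtain ⟨α, β, t, hα, hβ, hrel, hlt4, hiso⟩ :=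
    isoB16 C.hp C.hq C.hpq h a d C.hh hd2 C.he hda ha6
  obtain ⟨c0, hc0⟩ : pqFib p q a ∣ pqFib p q (h * a) := fdvd16' (Dvd.intro_left _ rfl)
  have hc0pos : 0 < c0 := by
    have := fpos16 C.hp C.hq (h * a) (Nat.mul_pos C.hh C.ha)
    rcases Nat.eq_zero_or_pos c0 with h0 | h0
    · rw [h0] at hc0; omega
    · exact h0
  obtain ⟨i0, hi0⟩ : ∃ x : Fin n, (x : ℕ) = 0 := ⟨⟨0, by omega⟩, rfl⟩
  obtain ⟨i1, hi1⟩ : ∃ x : Fin n, (x : ℕ) = 1 := ⟨⟨1, by omega⟩, rfl⟩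
  obtain ⟨i2, hi2⟩ : ∃ x : Fin n, (x : ℕ) = 2 := ⟨⟨2, by omega⟩, rfl⟩
  obtain ⟨i3, hi3⟩ : ∃ x : Fin n, (x : ℕ) = 3 := ⟨⟨3, by omega⟩, rfl⟩
  have A0 := C.hA0 i0 hi0
  have A1 := C.hA1 i1 (by omega)
  have A2 := C.hA1 i2 (by omega)
  have A3 := C.hA1 i3 (by omega)
  rw [hi1] at A1
  rw [hi2] at A2
  rw [hi3] at A3
  have n01 : i0 ≠ i1 := fun hx => by rw [hx] at hi0; omega
  have n02 : i0 ≠ i2 := fun hx => by rw [hx] at hi0; omega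
  have n03 : i0 ≠ i3 := fun hx => by rw [hx] at hi0; omega
  have n12 : i1 ≠ i2 := fun hx => by rw [hx] at hi1; omega
  have n13 : i1 ≠ i3 := fun hx => by rw [hx] at hi1; omega
  have n23 : i2 ≠ i3 := fun hx => by rw [hx] at hi2; omega
  obtain ⟨w0, hw0⟩ : ∃ w0, w0 = (t + 1) * q ^ d * c0 := ⟨_, rfl⟩
  have hw0pos : 0 < w0 := by
    rw [hw0]; have := C.hq; positivity
  have hrel' : α * A i1 + β * A i2 = A i3 + w0 * A i0 := by
    rw [A0, A1, A2, A3, hrel, hw0, hc0]; ring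
  obtain ⟨E, hE⟩ : ∃ E : Fin n →₀ ℕ, E = Finsupp.single i1 α + Finsupp.single i2 β := ⟨_, rfl⟩
  obtain ⟨W, hW⟩ : ∃ W : Fin n →₀ ℕ, W = Finsupp.single i3 1 + Finsupp.single i0 w0 := ⟨_, rfl⟩
  have E1 : E i1 = α := by simp [hE, n12.symm]
  have E2 : E i2 = β := by simp [hE, n12]
  have E0 : E i0 = 0 := by simp [hE, n01.symm, n02.symm]
  have W3 : W i3 = 1 := by simp [hW, n03]
  have W0 : W i0 = w0 := by simp [hW, n03.symm]
  have wE : wt16 A E = α * A i1 + β * A i2 := by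
    rw [hE, wt16_add, wt16_single, wt16_single]
  have wW : wt16 A W = A i3 + w0 * A i0 := by
    rw [hW, wt16_add, wt16_single, wt16_single, one_mul]
  obtain ⟨i', l, hil, hel, hrl, M', hM', hiM', hlM', hTi', hTl'⟩ :=
    critO16 C k hCI (fun x => x = j) E W (fun x y hx hy => hx.trans hy.symm) (fun _ => by
      refine ⟨by rw [wE, wW, hrel'], ?_, ?_, ?_, ?_⟩
      · intro hc
        rw [← hc] at E0
        omega
      · rintro m' hm' ⟨l, hl1, hl2⟩
        have hbig : ∀ x : Fin n, 4 ≤ (x : ℕ) → m' x = 0 := by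
          intro x hx
          by_contra hne
          have h1 := wt16_le A m' x
          have h2 : A x ≤ m' x * A x := Nat.le_mul_of_pos_left _ (by omega)
          rw [hm', wE, A1, A2] at h1
          rw [C.hA1 x (by omega)] at h1 h2
          have h3 : pqFib p q (h * a + 4 * d) ≤ pqFib p q (h * a + x * d) := by
            apply fmono16 C.hp C.hq
            have := Nat.mul_le_mul_right d hx
            omega
          omega
        have hdec : m' = Finsupp.single i0 (m' i0) + Finsupp.single i1 (m' i1) +
            Finsupp.single i2 (m' i2) + Finsupp.single i3 (m' i3) := by
          ext x
          simp only [Finsupp.add_apply, Finsupp.single_apply]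
          by_cases h4 : 4 ≤ (x : ℕ)
          · rw [hbig x h4, if_neg (by rintro rfl; omega), if_neg (by rintro rfl; omega),
              if_neg (by rintro rfl; omega), if_neg (by rintro rfl; omega)]; rfl
          · rcases (show (x : ℕ) = 0 ∨ (x : ℕ) = 1 ∨ (x : ℕ) = 2 ∨ (x : ℕ) = 3 by omega)
              with h5 | h5 | h5 | h5
            · have : x = i0 := Fin.ext (by omega)
              subst this; simp [n01.symm, n02.symm, n03.symm]
            · have : x = i1 := Fin.ext (by omega)
              subst this; simp [n01, n12.symm, n13.symm]
            · have : x = i2 := Fin.ext (by omega)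
              subst this; simp [n02, n12, n23.symm]
            · have : x = i3 := Fin.ext (by omega)
              subst this; simp [n03, n13, n23]
        have hwm : m' i0 * A i0 + m' i1 * A i1 + m' i2 * A i2 + m' i3 * A i3 =
            α * A i1 + β * A i2 := by
          rw [← wE, ← hm']
          conv_rhs => rw [hdec]
          simp only [wt16_add, wt16_single]
        rw [A0, A1, A2, A3] at hwm
        have hor : m' i1 ≠ 0 ∨ m' i2 ≠ 0 := by
          by_cases hx1 : l = i1
          · left; rw [← hx1]; exact hl2
          · by_cases hx2 : l = i2
            · right; rw [← hx2]; exact hl2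
            · exfalso; apply hl1
              simp [hE, Ne.symm hx1, Ne.symm hx2]
        obtain ⟨r0, r1, r2, r3⟩ := hiso _ _ _ _ hwm hor
        rw [hdec, r0, r1, r2, r3, hE]
        simp
      · intro x hx
        constructor
        · by_cases hx0 : (x : ℕ) = 0
          · exact ⟨i1, by omega, And01_16 C _ _ hx0 hi1⟩
          · by_cases hx1 : (x : ℕ) = 1
            · exact ⟨i2, by omega, Ands16 C _ _ hx0 (by omega)⟩
            · exact ⟨i1, by omega, Andvd16 C _ _ (by omega)⟩
        · by_cases hx0 : (x : ℕ) = 0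
          · refine ⟨i3, by omega, ?_⟩
            rw [C.hA0 x hx0, A3]
            intro hdv
            have h1 := Nat.le_of_dvd (by omega) (dva16 C _ hdv)
            omega
          · exact ⟨i0, by omega, Andvd16 C _ _ (by omega)⟩
      · intro r
        constructor
        · intro hc
          rw [hc, Finsupp.single_apply] at E1 E2
          by_cases hr : r = i1
          · rw [if_neg (by rw [hr]; exact n12)] at E2; omega
          · rw [if_neg hr] at E1; omega
        · intro hc
          rw [hc, Finsupp.single_apply] at W3 W0
          by_cases hr : r = i0
          · rw [if_neg (by rw [hr]; exact n03)] at W3; omega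
          · rw [if_neg hr] at W0; omega)
  obtain ⟨hi', hl2, -, -, hl3⟩ := pair_16 C i' l hil hrl M' hM' hiM' hlM' hTi' hTl'
  have hii : i' = i := Fin.ext (by omega)
  subst hii
  have hgen : ∀ (j : Fin n) (M M' : ℕ), (j : ℕ) ≠ 0 → ¬ Red16 A j → 0 < M → A i' ∣ M → A j ∣ M →
      (∀ c, 0 < c → Tm16 A i' c → M' ≤ c * A i') → M' ≤ M := by
    intro j M M' hj hr hM h1 h2 hT
    obtain ⟨c, hc⟩ := h1
    obtain ⟨b, hb⟩ := h2
    have hnd := Red0_16 C i' j hi' hj hr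
    have hc0 : 0 < c := by
      rcases Nat.eq_zero_or_pos c with h0 | h0
      · rw [h0] at hc; omega
      · exact h0
    have := hT c hc0 (Tm2_16 A i' j j c b 0 hnd hnd (by
      rw [zero_mul, add_zero, mul_comm b, ← hb, hc, mul_comm]))
    rw [hc, mul_comm]; exact this
  have q1 := hgen j M M' (by omega) hrj hM hiM hjM hTi'
  have q2 := hgen l M' M (by omega) hrl hM' hiM' hlM' hTi
  have hMM : M = M' := le_antisymm q2 q1
  subst hMM
  rcases lt_trichotomy (j : ℕ) l with h1 | h1 | h1
  · exact pair1_16 C j l (by omega) h1 M hM hjM hlM' hTj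
  · exact hel (Fin.ext h1.symm)
  · exact pair1_16 C l j (by omega) h1 M hM hlM' hjM hTl'

lemma fwd16 (k : Type*) [Field k] (hCI : IsCI k A) : n = 3 ∧ 2 * d ∣ a := by
  have hn := C.hn
  have hn3 : n = 3 := by
    by_contra hc
    exact n4_16 C k hCI (by omega)
  refine ⟨hn3, ?_⟩
  obtain ⟨i, j, hij, -, hrj, M, hM, hiM, hjM, hTi, hTj⟩ :=
    critO16 C k hCI (fun _ => False) 0 0 (fun _ _ h => h.elim) (fun ⟨_, h⟩ => h.elim)
  obtain ⟨hi, hj2, hjd, hne, -⟩ := pair_16 C i j hij hrj M hM hiM hjM hTi hTj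
  have := j.2
  have hj : (j : ℕ) = 2 := by omega
  rw [hj] at hjd
  exact hjd

end ctx16
lemma bwdA16 (k : Type*) [Field k] (A : Fin 3 → ℕ) (L w u v : ℕ) (hL : 0 < L)
    (hw0 : L * A 1 = A 2 + w * A 0) (hw1 : u * A 0 = v * A 2)
    (hdet : ∀ x0 x1 x2 y0 y1 y2, x0 * A 0 + x1 * A 1 + x2 * A 2 = y0 * A 0 + y1 * A 1 + y2 * A 2 →
      x1 < L → y1 < L → x1 = y1)
    (hdet2 : ∀ x0 x2 y0 y2, x0 * A 0 + x2 * A 2 = y0 * A 0 + y2 * A 2 → x0 ≤ y0 →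
      ∃ c, y0 = x0 + c * u ∧ x2 = y2 + c * v) : IsCI k A := by
  let g : Fin 2 → MvPolynomial (Fin 3) k :=
    ![X 1 ^ L - X 2 * X 0 ^ w, X 0 ^ u - X 2 ^ v]
  refine ⟨g, le_antisymm ?_ ?_⟩
  · rw [Ideal.span_le]
    rintro _ ⟨i, rfl⟩
    rw [SetLike.mem_coe, mem_toric16]
    fin_cases i
    · simp only [g, Fin.zero_eta, Matrix.cons_val_zero, map_sub, map_mul, map_pow, aeval_X,
        ← pow_mul, ← pow_add]
      rw [mul_comm (A 1), hw0, mul_comm w, sub_self]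
    · simp only [g, Fin.mk_one, Matrix.cons_val_one, Matrix.cons_val_fin_one, map_sub, map_pow,
        aeval_X, ← pow_mul]
      rw [mul_comm (A 0), hw1, mul_comm v, sub_self]
  · apply toric_le16
    intro m m' hmm
    rw [← Ideal.Quotient.eq]
    set J := Ideal.span (Set.range g) with hJ
    set φ := Ideal.Quotient.mk J with hφ
    have r0 : φ (X 1) ^ L = φ (X 2) * φ (X 0) ^ w := by
      have : g 0 ∈ J := Ideal.subset_span ⟨0, rfl⟩
      have h2 := (Ideal.Quotient.eq_zero_iff_mem).2 this
      simp only [g, Matrix.cons_val_zero, map_sub, map_mul, map_pow] at h2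
      exact sub_eq_zero.1 h2
    have r1 : φ (X 0) ^ u = φ (X 2) ^ v := by
      have : g 1 ∈ J := Ideal.subset_span ⟨1, rfl⟩
      have h2 := (Ideal.Quotient.eq_zero_iff_mem).2 this
      simp only [g, Matrix.cons_val_one, Matrix.cons_val_fin_one, map_sub, map_pow] at h2
      exact sub_eq_zero.1 h2
    have hmon : ∀ m : Fin 3 →₀ ℕ, φ (monomial m 1) =
        φ (X 0) ^ (m 0 + w * (m 1 / L)) * φ (X 1) ^ (m 1 % L) * φ (X 2) ^ (m 2 + m 1 / L) := by
      intro m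
      rw [monomial_eq, Finsupp.prod_fintype _ _ (by simp), Fin.prod_univ_three]
      simp only [map_one, one_mul, map_mul, map_pow]
      have e1 : φ (X 1) ^ (m 1) = φ (X 1) ^ (m 1 % L) * (φ (X 2) * φ (X 0) ^ w) ^ (m 1 / L) := by
        rw [← r0, ← pow_mul, ← pow_add, Nat.mod_add_div]
      rw [e1, pow_add, pow_add, pow_mul, mul_pow]
      ring
    have hwt : ∀ m : Fin 3 →₀ ℕ, wt16 A m = (m 0 + w * (m 1 / L)) * A 0 + (m 1 % L) * A 1 +
        (m 2 + m 1 / L) * A 2 := by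
      intro m
      rw [wt16, Fin.sum_univ_three]
      have e1 : m 1 * A 1 = (m 1 % L) * A 1 + (m 1 / L) * (L * A 1) := by
        conv_lhs => rw [← Nat.mod_add_div (m 1) L]
        ring
      rw [e1, hw0]; ring
    rw [hwt m, hwt m'] at hmm
    have h1 := hdet _ _ _ _ _ _ hmm (Nat.mod_lt _ hL) (Nat.mod_lt _ hL)
    rw [hmon m, hmon m', h1]
    rw [h1] at hmm
    generalize m 0 + w * (m 1 / L) = x0 at *
    generalize m' 0 + w * (m' 1 / L) = y0 at *
    generalize m 2 + m 1 / L = x2 at *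
    generalize m' 2 + m' 1 / L = y2 at *
    have hmm2 : x0 * A 0 + x2 * A 2 = y0 * A 0 + y2 * A 2 := by omega
    rcases le_total x0 y0 with h2 | h2
    · obtain ⟨c, rfl, rfl⟩ := hdet2 _ _ _ _ hmm2 h2
      rw [pow_add, pow_add, mul_comm c u, mul_comm c v, pow_mul, pow_mul, r1]; ring
    · obtain ⟨c, rfl, rfl⟩ := hdet2 _ _ _ _ hmm2.symm h2
      rw [pow_add, pow_add, mul_comm c u, mul_comm c v, pow_mul, pow_mul, r1]; ring

lemma bwd16 {p q h a d : ℕ} {A : Fin 3 → ℕ} (C : Ctx16 p q h a d 3 A) (k : Type*) [Field k]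
    (hda : 2 * d ∣ a) : IsCI k A := by
  have hd2 := C.hd2
  have hd : 0 < d := by omega
  have hL := Ld16 C.hp C.hq d hd2
  have A0 := C.hA0 0 rfl
  have A1 := C.hA1 1 (by simp)
  have A2 := C.hA1 2 (by simp)
  simp only [Fin.val_one, Fin.val_two] at A1 A2
  have h2d := f2d16 (p := p) (q := q) d hd
  have e2 := flucE16 (p := p) (q := q) d hd C.he (h * a)
  have hFd := fpos16 C.hp C.hq d hd
  have hF2d := fpos16 C.hp C.hq (2 * d) (by omega)
  obtain ⟨c0, hc0⟩ : pqFib p q a ∣ pqFib p q (h * a) := fdvd16' (Dvd.intro_left _ rfl)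
  have hdha : 2 * d ∣ h * a := Dvd.dvd.mul_left hda h
  have hg02 : Nat.gcd (pqFib p q a) (pqFib p q (h * a + 2 * d)) = pqFib p q (2 * d) := by
    rw [fgcd16 C.hpq]; congr 1
    rw [show Nat.gcd a (h * a + 2 * d) = Nat.gcd a (2 * d) by simp]
    exact Nat.gcd_eq_right hda
  have hg1 : Nat.gcd (pqFib p q (h * a + 1 * d)) (pqFib p q (2 * d)) = pqFib p q d := by
    rw [fgcd16 C.hpq]; congr 1
    obtain ⟨c, hc⟩ := hdha
    rw [hc, show 2 * d * c + 1 * d = d + 2 * d * c by ring, Nat.gcd_add_mul_left_left]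
    exact Nat.gcd_eq_left (Dvd.intro_left _ rfl)
  obtain ⟨v, hv⟩ : pqFib p q (2 * d) ∣ pqFib p q a := fdvd16' hda
  obtain ⟨u, hu⟩ : pqFib p q (2 * d) ∣ pqFib p q (h * a + 2 * d) :=
    fdvd16' (dvd_add hdha dvd_rfl)
  obtain ⟨b, hb⟩ : pqFib p q d ∣ pqFib p q (h * a + 1 * d) := by
    rw [← hg1]; exact Nat.gcd_dvd_left _ _
  have huv : Nat.Coprime u v := by
    rw [hv, hu, Nat.gcd_mul_left] at hg02
    have : Nat.gcd v u = 1 := Nat.eq_of_mul_eq_mul_left hF2d (by rw [mul_one]; exact hg02)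
    exact Nat.Coprime.symm this
  have hbL : Nat.Coprime (L16 p q d) b := by
    rw [hb, h2d, mul_comm (L16 p q d), Nat.gcd_mul_left] at hg1
    have : Nat.gcd b (L16 p q d) = 1 := Nat.eq_of_mul_eq_mul_left hFd (by rw [mul_one]; exact hg1)
    exact Nat.Coprime.symm this
  have hu0 : 0 < u := by
    rcases Nat.eq_zero_or_pos u with h0 | h0
    · have := fpos16 C.hp C.hq (h * a + 2 * d) (by omega)
      rw [hu, h0] at this; simp at this
    · exact h0
  refine bwdA16 k A (L16 p q d) (q ^ d * c0) u v (by omega) ?_ ?_ ?_ ?_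
  · rw [A0, A1, A2, one_mul, ← e2, hc0]; ring
  · rw [A0, A2, hv, hu]; ring
  · intro x0 x1 x2 y0 y1 y2 hx h1 h2
    rw [A0, A1, A2, hv, hu, hb, h2d] at hx
    have hcong : (L16 p q d : ℤ) ∣ (x1 : ℤ) - y1 := by
      apply (show IsCoprime (L16 p q d : ℤ) (b : ℤ) from hbL.isCoprime).dvd_of_dvd_mul_left
      have hfz : (pqFib p q d : ℤ) ≠ 0 := by exact_mod_cast hFd.ne'
      apply (mul_dvd_mul_iff_left hfz).1
      refine ⟨((y0 : ℤ) - x0) * v + (y2 - x2) * u, ?_⟩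
      zify at hx
      linear_combination hx
    have hz := Int.eq_zero_of_abs_lt_dvd hcong (by
      rw [abs_lt]; constructor <;> omega)
    omega
  · intro x0 x2 y0 y2 hx hle
    obtain ⟨e, rfl⟩ := exists_add_of_le hle
    rw [A0, A2, hv, hu] at hx
    have hx2 : x2 * u = e * v + y2 * u := by
      apply Nat.eq_of_mul_eq_mul_left hF2d
      linarith
    have hdv : u ∣ e := by
      apply huv.dvd_of_dvd_mul_right
      refine (Nat.dvd_add_left (Dvd.intro_left y2 rfl)).1 ?_
      rw [← hx2]; exact Dvd.intro_left _ rfl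
    obtain ⟨c, rfl⟩ := hdv
    refine ⟨c, by ring, ?_⟩
    apply Nat.eq_of_mul_eq_mul_right hu0
    rw [hx2]; ring


/-- With `d₁ = F_a`, `d_i = F_{h·a + (i−1)·d}` for `2 ≤ i ≤ n` in
the `(p,q)`-Fibonacci sequence and `n ≥ 3`, if `d₃ ∉ ℕd₁ + ℕd₂`, then `I_A` is a
complete intersection iff `n = 3` and `2d ∣ a`. -/
theorem stmt16 (k : Type*) [Field k] (p q : ℕ) (hp : 0 < p) (hq : 0 < q)
    (hpq : Nat.gcd p q = 1) (h a d : ℕ) (hh : 0 < h) (ha : 0 < a) (hd : 0 < d)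
    (n : ℕ) (hn : 3 ≤ n)
    (A : Fin n → ℕ)
    (hA : ∀ i : Fin n,
      A i = if (i : ℕ) = 0 then pqFib p q a else pqFib p q (h * a + (i : ℕ) * d))
    (hd3 : ¬ ∃ α β : ℕ, A ⟨2, by omega⟩ = α * A ⟨0, by omega⟩ + β * A ⟨1, by omega⟩) :
    IsCI k A ↔ (n = 3 ∧ 2 * d ∣ a) := by
  have hA0 : ∀ i : Fin n, (i : ℕ) = 0 → A i = pqFib p q a := by
    intro i hi; rw [hA i, if_pos hi]
  have hA1 : ∀ i : Fin n, (i : ℕ) ≠ 0 → A i = pqFib p q (h * a + (i : ℕ) * d) := by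
    intro i hi; rw [hA i, if_neg hi]
  have hd3' : ¬ ∃ α β : ℕ, pqFib p q (h * a + 2 * d) =
      α * pqFib p q a + β * pqFib p q (h * a + 1 * d) := by
    rintro ⟨α, β, hx⟩
    apply hd3
    refine ⟨α, β, ?_⟩
    rw [hA0 ⟨0, by omega⟩ rfl, hA1 ⟨1, by omega⟩ (by simp), hA1 ⟨2, by omega⟩ (by simp)]
    exact hx
  have he : Even d := by
    by_contra ho
    rw [Nat.not_even_iff_odd] at ho
    obtain ⟨c, hc⟩ : pqFib p q a ∣ pqFib p q (h * a) := fdvd16' (Dvd.intro_left _ rfl)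
    have e := flucO16 (p := p) (q := q) d ho (h * a)
    exact hd3' ⟨q ^ d * c, L16 p q d, by rw [e, hc, one_mul]; ring⟩
  have hd2 : 2 ≤ d := by rcases he with ⟨r, hr⟩; omega
  have C : Ctx16 p q h a d n A := ⟨hp, hq, hpq, hh, ha, hd2, he, hn, hA0, hA1, hd3'⟩
  constructor
  · exact fwd16 C k
  · rintro ⟨rfl, hda⟩
    exact bwd16 C k hda
end

section
/- Let p, q be relatively prime positive integers, {L_n} the (p,q)-Lucas sequence, and let a, d be positive integers and n ≥ 3. Set d_i = L_{a + (i−1)·d} for 1 ≤ i ≤ n and A = {d_1, …, d_n}. If d_3 does not belong to the semigroup ℕd_1 + ℕd_2, then the toric ideal I_A is a complete intersection if and only if n = 3, d divides a, a/d is odd, and gcd(d_1, d_2) = 1. -/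
open MvPolynomial

namespace Luc
variable {p q : ℕ}

lemma rec2 (m : ℕ) : pqLucas p q (m+2) = p * pqLucas p q (m+1) + q * pqLucas p q m := rfl

lemma id1 (n : ℕ) : ∀ m : ℕ, (pqLucas p q (m+2*n) : ℤ) + (-(q:ℤ))^n * pqLucas p q m
    = pqLucas p q n * pqLucas p q (m+n) := by
  induction n using Nat.twoStepInduction with
  | zero => intro m; simp [pqLucas]; ring
  | one => intro m; simp [pqLucas]
  | more n h0 h1 =>
    intro m
    have a1 := h1 (m+1)
    have a0 := h0 (m+2)
    have e1 : m + 1 + 2*(n+1) = m+2*n+3 := by ring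
    have e2 : m + 2 + 2*n = m+2*n+2 := by ring
    have e3 : m + 2*(n+2) = (m+2*n+2)+2 := by ring
    have e4 : m + 1 + (n+1) = m+n+2 := by ring
    have e5 : m + 2 + n = m+n+2 := by ring
    have e6 : m + (n+2) = m+n+2 := by ring
    rw [e1, e4] at a1
    rw [e2, e5] at a0
    rw [e3, e6, rec2 (m+2*n+2), rec2 n]
    have r := rec2 (p := p) (q := q) m
    rw [r] at a0
    push_cast at *
    rw [pow_succ] at a1
    rw [pow_succ, pow_succ]
    have e7 : m + 2*n+2+1 = m+2*n+3 := by ring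
    rw [e7]
    linear_combination (p:ℤ) * a1 + (q:ℤ) * a0

lemma id_even {d : ℕ} (hd : Even d) (x : ℕ) : pqLucas p q (x+2*d) + q^d * pqLucas p q x
    = pqLucas p q d * pqLucas p q (x+d) := by
  have := id1 (p := p) (q := q) d x
  rw [hd.neg_pow] at this
  exact_mod_cast this

lemma id_odd {d : ℕ} (hd : Odd d) (x : ℕ) : pqLucas p q (x+2*d) 
    = pqLucas p q d * pqLucas p q (x+d) + q^d * pqLucas p q x := by
  have := id1 (p := p) (q := q) d x
  rw [hd.neg_pow] at this
  zify
  linarith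

lemma pos (hp : 0 < p) (m : ℕ) : 0 < pqLucas p q m := by
  induction m using Nat.twoStepInduction with
  | zero => simp [pqLucas]
  | one => simpa [pqLucas]
  | more n h0 h1 => rw [rec2]; positivity

lemma lt_succ (hp : 0 < p) (hq : 0 < q) (m : ℕ) (hm : 1 ≤ m) :
    pqLucas p q m < pqLucas p q (m+1) := by
  obtain ⟨m, rfl⟩ : ∃ j, m = j+1 := ⟨m-1, by omega⟩
  rw [rec2]
  have := pos (q := q) hp m
  have h2 : 0 < q * pqLucas p q m := by positivity
  nlinarith [pos (q := q) hp (m+1)]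

lemma lt_of_lt (hp : 0 < p) (hq : 0 < q) {m n : ℕ} (hm : 1 ≤ m) (h : m < n) :
    pqLucas p q m < pqLucas p q n := by
  induction n, h using Nat.le_induction with
  | base => exact lt_succ hp hq m hm
  | succ n h ih => exact ih.trans (lt_succ hp hq n (by omega))

lemma le_of_le (hp : 0 < p) (hq : 0 < q) {m n : ℕ} (hm : 1 ≤ m) (h : m ≤ n) :
    pqLucas p q m ≤ pqLucas p q n := by
  rcases h.eq_or_lt with h | h
  · rw [h]
  · exact (lt_of_lt hp hq hm h).le

lemma three_le (hp : 0 < p) (hq : 0 < q) {n : ℕ} (h : 2 ≤ n) : 3 ≤ pqLucas p q n := by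
  refine le_trans ?_ (le_of_le hp hq (by norm_num) h)
  simp [pqLucas]; nlinarith

lemma qpow_le (n m : ℕ) : q^n * pqLucas p q m ≤ pqLucas p q (m+2*n) := by
  induction n with
  | zero => simp
  | succ n ih =>
    have : m + 2*(n+1) = (m+2*n)+2 := by ring
    rw [this, rec2, pow_succ]
    nlinarith [Nat.zero_le (p * pqLucas p q (m+2*n+1))]

lemma qpow_lt (hp : 0 < p) (hq : 0 < q) (n m : ℕ) (hn : 1 ≤ n) : q^n * pqLucas p q m < pqLucas p q (m+2*n) := by
  obtain ⟨n, rfl⟩ : ∃ j, n = j+1 := ⟨n-1, by omega⟩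
  have h := qpow_le (p := p) (q := q) n m
  have : m + 2*(n+1) = (m+2*n)+2 := by ring
  rw [this, rec2, pow_succ]
  have h2 : 0 < p * pqLucas p q (m+2*n+1) := Nat.mul_pos hp (pos hp _)
  nlinarith

lemma mul_le_aux (hp : 0 < p) (hq : 0 < q) (k r : ℕ) (hk : 1 ≤ k) (h : 3 ≤ r + 2*k) :
    pqLucas p q k * pqLucas p q (r+k) ≤ pqLucas p q (r+2*k+1) := by
  obtain ⟨k, rfl⟩ : ∃ j, k = j+1 := ⟨k-1, by omega⟩
  have h1 := id1 (p := p) (q := q) (k+1) r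
  have h2 : (-(q:ℤ))^(k+1) ≤ (q:ℤ)^(k+1) := by
    calc _ ≤ |(-(q:ℤ))^(k+1)| := le_abs_self _
      _ = _ := by rw [abs_pow, abs_neg, Nat.abs_cast]
  have h3 := qpow_le (p := p) (q := q) k r
  have h4 : pqLucas p q (r+2*k) ≤ pqLucas p q (r+2*k+1) := le_of_le hp hq (by omega) (by omega)
  have e : r + 2*(k+1) + 1 = (r+2*k+1)+2 := by ring
  have e' : r + 2*(k+1) = (r+2*k+1)+1 := by ring
  rw [e, rec2]
  rw [e'] at h1
  have h7 : (0:ℤ) < pqLucas p q (r+2*k+1+1) := by exact_mod_cast pos hp _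
  zify at *
  have h5 := mul_le_mul_of_nonneg_right h2 (Int.natCast_nonneg (pqLucas p q r))
  have h6 : (q:ℤ)^(k+1) * pqLucas p q r ≤ q * pqLucas p q (r+2*k+1) := by
    rw [pow_succ]; nlinarith
  nlinarith

lemma mul_le (hp : 0 < p) (hq : 0 < q) (k m : ℕ) (hk : 1 ≤ k) (hm : 1 ≤ m) (h : 3 ≤ m + k) :
    pqLucas p q k * pqLucas p q m ≤ pqLucas p q (m+k+1) := by
  rcases le_total k m with hh | hh
  · obtain ⟨r, rfl⟩ := Nat.exists_eq_add_of_le hh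
    have := mul_le_aux hp hq k r hk (by omega)
    rw [show r + 2*k+1 = k + r + k + 1 by ring, add_comm r k] at this
    exact this
  · obtain ⟨r, rfl⟩ := Nat.exists_eq_add_of_le hh
    have := mul_le_aux hp hq m r hm (by omega)
    rw [show r + 2*m+1 = m + (m+r) + 1 by ring, add_comm r m] at this
    rw [mul_comm]
    exact this

lemma cop (hpq : Nat.gcd p q = 1) (m : ℕ) (hm : 1 ≤ m) : Nat.Coprime (pqLucas p q m) q := by
  obtain ⟨m, rfl⟩ : ∃ j, m = j+1 := ⟨m-1, by omega⟩
  induction m with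
  | zero => simpa [pqLucas] using hpq
  | succ n ih =>
    have := ih (by omega)
    show Nat.Coprime (pqLucas p q (n+2)) q
    rw [rec2, Nat.coprime_add_mul_left_left]
    exact Nat.Coprime.mul_left hpq this

lemma copZ (hpq : Nat.gcd p q = 1) (m n : ℕ) (hm : 1 ≤ m) :
    IsCoprime (pqLucas p q m : ℤ) ((-(q:ℤ))^n) := by
  apply IsCoprime.pow_right
  apply IsCoprime.neg_right
  exact Nat.isCoprime_iff_coprime.mpr (cop hpq m hm)

/-- divisibility transfer -/
lemma dvd_down (hpq : Nat.gcd p q = 1) (z n m x : ℕ) (hz : z ∣ pqLucas p q x) (hx : 1 ≤ x)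
    (h1 : z ∣ pqLucas p q (m+2*n)) (h2 : z ∣ pqLucas p q n * pqLucas p q (m+n)) :
    z ∣ pqLucas p q m := by
  have h := id1 (p := p) (q := q) n m
  have c : IsCoprime (z : ℤ) ((-(q:ℤ))^n) :=
    (copZ hpq x n hx).of_isCoprime_of_dvd_left (by exact_mod_cast hz)
  have : (z:ℤ) ∣ (-(q:ℤ))^n * pqLucas p q m := by
    rw [← (Int.dvd_add_right (a := (z:ℤ)) (b := (pqLucas p q (m+2*n) : ℤ)) (by exact_mod_cast h1)), h]
    exact_mod_cast h2
  exact_mod_cast c.dvd_of_dvd_mul_left this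

lemma dvd_up (z n m : ℕ) (h1 : z ∣ pqLucas p q m) (h2 : z ∣ pqLucas p q n * pqLucas p q (m+n)) :
    z ∣ pqLucas p q (m+2*n) := by
  have h := id1 (p := p) (q := q) n m
  have h1' : (z:ℤ) ∣ pqLucas p q m := by exact_mod_cast h1
  have h2' : (z:ℤ) ∣ pqLucas p q n * pqLucas p q (m+n) := by exact_mod_cast h2
  have : (z:ℤ) ∣ pqLucas p q (m+2*n) := by
    rw [show (pqLucas p q (m+2*n) : ℤ) = pqLucas p q n * pqLucas p q (m+n) - (-(q:ℤ))^n * pqLucas p q m by linarith]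
    exact dvd_sub h2' (h1'.mul_left _)
  exact_mod_cast this

lemma gcd_step (hpq : Nat.gcd p q = 1) (x d : ℕ) (hd : 1 ≤ d) :
    Nat.gcd (pqLucas p q (x+d)) (pqLucas p q (x+2*d)) = Nat.gcd (pqLucas p q x) (pqLucas p q (x+d)) := by
  apply Nat.dvd_antisymm
  · apply Nat.dvd_gcd _ (Nat.gcd_dvd_left _ _)
    exact dvd_down hpq _ d x (x+d) (Nat.gcd_dvd_left _ _) (by omega) (Nat.gcd_dvd_right _ _)
      ((Nat.gcd_dvd_left _ _).mul_left _)
  · apply Nat.dvd_gcd (Nat.gcd_dvd_right _ _)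
    exact dvd_up _ d x (Nat.gcd_dvd_left _ _) ((Nat.gcd_dvd_right _ _).mul_left _)

lemma gcd_all (hpq : Nat.gcd p q = 1) (x d : ℕ) (hd : 1 ≤ d) (i : ℕ) :
    Nat.gcd (pqLucas p q (x+i*d)) (pqLucas p q (x+(i+1)*d)) = Nat.gcd (pqLucas p q x) (pqLucas p q (x+d)) := by
  induction i with
  | zero => simp
  | succ i ih =>
    rw [← ih, show x + (i+1)*d = (x+i*d)+d by ring, show x + (i+1+1)*d = (x+i*d)+2*d by ring]
    exact gcd_step hpq _ d hd

lemma gcd_le (hp : 0 < p) (hq : 0 < q) (hpq : Nat.gcd p q = 1) (k : ℕ) (hk : 2 ≤ k) (a : ℕ) :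
    Nat.gcd (pqLucas p q a) (pqLucas p q (a+2*k)) ≤ pqLucas p q k := by
  induction a using Nat.strong_induction_on with
  | _ a ih =>
  have hk3 := three_le hp hq hk
  rcases Nat.eq_zero_or_pos a with h0 | h0
  · subst h0
    refine (Nat.le_of_dvd (pos hp _) (Nat.gcd_dvd_left _ _)).trans ?_
    simp [pqLucas]; omega
  rcases le_or_gt a k with h1 | h1
  · exact (Nat.le_of_dvd (pos hp _) (Nat.gcd_dvd_left _ _)).trans (le_of_le hp hq h0 h1)
  rcases lt_or_ge a (2*k) with h2 | h2
  · obtain ⟨m, hm⟩ := Nat.exists_eq_add_of_le h2.le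
    have : Nat.gcd (pqLucas p q a) (pqLucas p q (a+2*k)) ∣ pqLucas p q m := by
      apply dvd_down hpq _ a m a (Nat.gcd_dvd_left _ _) h0
      · rw [show m + 2*a = a + 2*k by omega]; exact Nat.gcd_dvd_right _ _
      · exact (Nat.gcd_dvd_left _ _).mul_right _
    exact (Nat.le_of_dvd (pos hp _) this).trans (le_of_le hp hq (by omega) (by omega))
  · obtain ⟨b, rfl⟩ := Nat.exists_eq_add_of_le h2
    refine le_trans (Nat.le_of_dvd (Nat.gcd_pos_of_pos_left _ (pos hp _)) ?_) (ih b (by omega))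
    rw [show b + 2*k = 2*k+b by ring]
    apply Nat.dvd_gcd _ (Nat.gcd_dvd_left _ _)
    apply dvd_down hpq _ (2*k) b (2*k+b) (Nat.gcd_dvd_left _ _) (by omega)
    · rw [show b + 2*(2*k) = 2*k+b+2*k by ring]; exact Nat.gcd_dvd_right _ _
    · rw [show b + 2*k = 2*k+b by ring]; exact (Nat.gcd_dvd_left _ _).mul_left _

lemma dvd_index (hp : 0 < p) (hq : 0 < q) (hpq : Nat.gcd p q = 1) (d : ℕ) (hd : 2 ≤ d) (a : ℕ)
    (h : pqLucas p q d ∣ pqLucas p q a) : ∃ t, a = d * (2*t+1) := by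
  induction a using Nat.strong_induction_on with
  | _ a ih =>
  have hk3 := three_le hp hq hd
  rcases Nat.eq_zero_or_pos a with h0 | h0
  · subst h0
    have := Nat.le_of_dvd (by simp [pqLucas]) h
    simp [pqLucas] at this; omega
  rcases lt_trichotomy a d with h1 | h1 | h1
  · have := Nat.le_of_dvd (pos hp _) h
    have := lt_of_lt hp hq h0 h1
    omega
  · exact ⟨0, by simp [h1]⟩
  rcases lt_or_ge a (2*d) with h2 | h2
  · exfalso
    obtain ⟨m, hm⟩ := Nat.exists_eq_add_of_le h2.le
    obtain ⟨n, hn⟩ := Nat.exists_eq_add_of_le h1.le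
    have : pqLucas p q d ∣ pqLucas p q m := by
      apply dvd_down hpq _ n m d dvd_rfl (by omega)
      · rw [show m + 2*n = a by omega]; exact h
      · rw [show m + n = d by omega]; exact dvd_mul_left _ _
    have := Nat.le_of_dvd (pos hp _) this
    have := lt_of_lt hp hq (m := m) (n := d) (by omega) (by omega)
    omega
  · obtain ⟨b, rfl⟩ := Nat.exists_eq_add_of_le h2
    obtain ⟨t, ht⟩ := ih b (by omega) (by
      apply dvd_down hpq _ d b d dvd_rfl (by omega)
      · rw [add_comm]; exact h
      · exact dvd_mul_right _ _)
    exact ⟨t+1, by rw [ht]; ring⟩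

lemma even_mult (d : ℕ) (h : 2 ∣ pqLucas p q d) (m : ℕ) : 2 ∣ pqLucas p q (m*d) := by
  induction m using Nat.twoStepInduction with
  | zero => simp [pqLucas]
  | one => simpa
  | more n h0 h1 =>
    rw [show (n+2)*d = n*d+2*d by ring]
    exact dvd_up _ d _ h0 (h.mul_right _)

lemma odd_mult (d t : ℕ) : pqLucas p q d ∣ pqLucas p q (d*(2*t+1)) := by
  induction t with
  | zero => simp
  | succ t ih => 
    rw [show d*(2*(t+1)+1) = d*(2*t+1)+2*d by ring]
    exact dvd_up _ d _ ih (dvd_mul_right _ _)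

lemma odd_quot (hp : 0 < p) (hpq : Nat.gcd p q = 1) (d t : ℕ) (hd : 1 ≤ d) (h : 2 ∣ pqLucas p q d) :
    ∃ R : ℤ, Odd R ∧ (pqLucas p q (d*(2*t+1)) : ℤ) = pqLucas p q d * R := by
  have hq : Odd (-(q:ℤ)) := by
    rw [odd_neg]
    have := cop hpq d hd
    rcases Nat.even_or_odd q with hh | hh
    · exact absurd (Nat.dvd_gcd h hh.two_dvd) (by rw [this]; norm_num)
    · exact_mod_cast hh
  induction t with
  | zero => exact ⟨1, odd_one, by simp⟩
  | succ t ih => 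
    obtain ⟨R, hR, e⟩ := ih
    have h1 := id1 (p := p) (q := q) d (d*(2*t+1))
    have h2 := even_mult d h (2*t+2)
    rw [show d*(2*t+1)+d = (2*t+2)*d by ring, show d*(2*t+1)+2*d = d*(2*(t+1)+1) by ring] at h1
    refine ⟨pqLucas p q ((2*t+2)*d) - (-(q:ℤ))^d * R, ?_, ?_⟩
    · apply Even.sub_odd
      · exact_mod_cast (even_iff_two_dvd.mpr h2)
      · exact (hq.pow).mul hR
    · rw [e] at h1
      linear_combination h1

/-- number theory endgame -/
lemma gcd_one (hp : 0 < p) (hpq : Nat.gcd p q = 1) (d t g c : ℕ) (hd : 1 ≤ d)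
    (hg : g = Nat.gcd (pqLucas p q (d*(2*t+1))) (pqLucas p q (d*(2*t+1)+d)))
    (h : pqLucas p q (d*(2*t+1)) = g * c) (hc : pqLucas p q d ∣ c) : g = 1 := by
  have h1 := gcd_all hpq 0 d hd (2*t+1)
  rw [show 0 + (2*t+1)*d = d*(2*t+1) by ring, show 0 + (2*t+1+1)*d = d*(2*t+1)+d by ring, ← hg] at h1
  rw [zero_add] at h1
  have h0 : pqLucas p q 0 = 2 := rfl
  rw [h0] at h1
  have hg2 : g ∣ 2 := h1 ▸ Nat.gcd_dvd_left _ _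
  have hgd : g ∣ pqLucas p q d := h1 ▸ Nat.gcd_dvd_right _ _
  rcases (Nat.dvd_prime Nat.prime_two).mp hg2 with h2 | h2
  · exact h2
  · exfalso
    rw [h2] at hgd h
    obtain ⟨R, hR, e⟩ := odd_quot hp hpq d t hd hgd
    obtain ⟨s, rfl⟩ := hc
    rw [h] at e
    push_cast at e
    have hpos : (pqLucas p q d : ℤ) ≠ 0 := by exact_mod_cast (pos hp d).ne'
    have : R = 2 * s := mul_left_cancel₀ hpos (by linarith)
    rw [this] at hR
    exact (Int.not_odd_iff_even.mpr (even_two_mul _)) hR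

end Luc

namespace Tor
open MvPolynomial
variable {k : Type*} [Field k] {n : ℕ}

/-- weight -/
def wt (c : Fin n → ℕ) (s : Fin n →₀ ℕ) : ℕ := ∑ i, s i * c i

lemma wt_add (c : Fin n → ℕ) (s t : Fin n →₀ ℕ) : wt c (s + t) = wt c s + wt c t := by
  simp [wt, add_mul, Finset.sum_add_distrib]

lemma wt_single (c : Fin n → ℕ) (i : Fin n) (m : ℕ) : wt c (Finsupp.single i m) = m * c i := by
  unfold wt
  rw [Finset.sum_eq_single i]
  · simp
  · intro b _ hb; simp [Finsupp.single_eq_of_ne hb]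
  · simp

lemma aeval_mono (c : Fin n → ℕ) (s : Fin n →₀ ℕ) (r : k) :
    aeval (fun i : Fin n => (Polynomial.X : Polynomial k) ^ c i) (monomial s r)
      = Polynomial.monomial (wt c s) r := by
  rw [aeval_monomial, Finsupp.prod_fintype _ _ (by simp)]
  simp_rw [← pow_mul]
  rw [Finset.prod_pow_eq_pow_sum, ← Polynomial.C_mul_X_pow_eq_monomial]
  simp [wt, mul_comm]

lemma mem_toric (c : Fin n → ℕ) (f : MvPolynomial (Fin n) k) :
    f ∈ toricIdeal k c ↔ aeval (fun i : Fin n => (Polynomial.X : Polynomial k) ^ c i) f = 0 := by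
  unfold toricIdeal
  rw [RingHom.mem_ker]; rfl

lemma coeff_aeval (c : Fin n → ℕ) (f : MvPolynomial (Fin n) k) (D : ℕ) :
    (aeval (fun i : Fin n => (Polynomial.X : Polynomial k) ^ c i) f).coeff D
      = ∑ s ∈ f.support, if wt c s = D then coeff s f else 0 := by
  conv_lhs => rw [f.as_sum, map_sum, Polynomial.finsetSum_coeff]
  refine Finset.sum_congr rfl fun s _ => ?_
  rw [aeval_mono, Polynomial.coeff_monomial]

lemma coeff_unique (c : Fin n → ℕ) (f : MvPolynomial (Fin n) k) (hf : f ∈ toricIdeal k c)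
    (s : Fin n →₀ ℕ) (hs : ∀ t, wt c t = wt c s → t = s) : coeff s f = 0 := by
  rw [mem_toric] at hf
  have := coeff_aeval c f (wt c s)
  rw [hf, Polynomial.coeff_zero] at this
  by_contra h
  apply h
  rw [this, Finset.sum_eq_single s]
  · simp
  · intro t _ hne
    rw [if_neg]; exact fun hh => hne (hs t hh)
  · intro hh; simpa using hh

lemma coeff_mul_unique (c : Fin n → ℕ) (f h : MvPolynomial (Fin n) k) (hf : f ∈ toricIdeal k c)
    (i : Fin n) (m : ℕ)
    (hs : ∀ m' < m, ∀ t, wt c t = m' * c i → t = Finsupp.single i m') :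
    coeff (Finsupp.single i m) (h * f) = coeff 0 h * coeff (Finsupp.single i m) f := by
  classical
  rw [coeff_mul, Finsupp.antidiagonal_single, Finset.sum_map]
  rw [Finset.sum_eq_single (0, m)]
  · simp
  · rintro ⟨x, y⟩ hxy hne
    rw [Finset.HasAntidiagonal.mem_antidiagonal] at hxy
    simp only at hxy
    have : y < m := by
      rcases Nat.eq_zero_or_pos x with hx | hx
      · exfalso; apply hne; rw [hx] at hxy ⊢; simp at hxy; rw [hxy]
      · omega
    simp only [Function.Embedding.prodMap, Function.Embedding.coeFn_mk, Prod.map]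
    have h0 : coeff (Finsupp.single i y) f = 0 := by
      apply coeff_unique c f hf
      intro t ht
      rw [wt_single] at ht
      exact hs y this t ht
    convert mul_zero _
  · intro hh; simp at hh

theorem not_CI (hn : 1 ≤ n) (c : Fin n → ℕ) (m : Fin n → ℕ)
    (hs : ∀ i, ∀ m' < m i, ∀ t, wt c t = m' * c i → t = Finsupp.single i m')
    (b : Fin n → (Fin n →₀ ℕ)) (hb : ∀ i, wt c (b i) = m i * c i)
    (hb' : ∀ i j, b i ≠ Finsupp.single j (m j)) (hm : ∀ i, m i ≠ 0) : ¬ IsCI k c := by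
  classical
  rintro ⟨g, hg⟩
  let φ : MvPolynomial (Fin n) k →ₗ[k] (Fin n → k) :=
    LinearMap.pi fun i => lcoeff k (Finsupp.single i (m i))
  have hφ : ∀ f i, φ f i = coeff (Finsupp.single i (m i)) f := fun f i => rfl
  have key : ∀ f ∈ toricIdeal k c, φ f ∈ Submodule.span k (Set.range fun l => φ (g l)) := by
    intro f hf
    rw [← hg, Ideal.mem_span_range_iff_exists_fun] at hf
    obtain ⟨h, rfl⟩ := hf
    rw [map_sum]
    refine Submodule.sum_mem _ fun l _ => ?_
    have : φ (h l * g l) = coeff 0 (h l) • φ (g l) := by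
      funext i
      rw [Pi.smul_apply, hφ, hφ, smul_eq_mul]
      apply coeff_mul_unique c _ _ _ i (m i) (hs i)
      rw [← hg]; exact Ideal.subset_span ⟨l, rfl⟩
    rw [this]
    exact Submodule.smul_mem _ _ (Submodule.subset_span ⟨l, rfl⟩)
  have top : (⊤ : Submodule k (Fin n → k)) ≤ Submodule.span k (Set.range fun l => φ (g l)) := by
    rw [← (Pi.basisFun k (Fin n)).span_eq, Submodule.span_le]
    rintro _ ⟨i, rfl⟩
    have : (Pi.basisFun k (Fin n)) i = φ (monomial (Finsupp.single i (m i)) 1 - monomial (b i) 1) := by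
      funext j
      rw [hφ, coeff_sub, coeff_monomial, coeff_monomial, if_neg (hb' i j), sub_zero, Pi.basisFun_apply,
        Pi.single_apply]
      congr 1
      rw [Finsupp.single_eq_single_iff, eq_iff_iff]
      constructor
      · rintro rfl; simp
      · rintro (h | h)
        · exact h.1.symm
        · exact absurd h.1 (hm i)
    rw [this]
    apply key
    rw [mem_toric, map_sub, aeval_mono, aeval_mono, hb, wt_single, sub_self]
  have h1 := finrank_range_le_card (R := k) (fun l => φ (g l))
  rw [Set.finrank, top_le_iff.mp top, finrank_top, Module.finrank_fin_fun, Fintype.card_fin] at h1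
  omega

/-- binomials suffice -/
lemma toric_le (c : Fin n → ℕ) (J : Ideal (MvPolynomial (Fin n) k))
    (h : ∀ s t, wt c s = wt c t → Ideal.Quotient.mk J (monomial s 1) = Ideal.Quotient.mk J (monomial t 1)) :
    toricIdeal k c ≤ J := by
  classical
  intro f hf
  rw [mem_toric] at hf
  let ψ : Polynomial k →ₗ[k] (MvPolynomial (Fin n) k ⧸ J) :=
    (Polynomial.basisMonomials k).constr k fun D =>
      if hD : ∃ s, wt c s = D then Ideal.Quotient.mk J (monomial hD.choose 1) else 0
  have hψ : ∀ s, ψ (Polynomial.monomial (wt c s) 1) = Ideal.Quotient.mk J (monomial s 1) := by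
    intro s
    have := (Polynomial.basisMonomials k).constr_basis k (fun D =>
      if hD : ∃ s, wt c s = D then Ideal.Quotient.mk J (monomial hD.choose 1) else 0) (wt c s)
    rw [Polynomial.coe_basisMonomials] at this
    refine this.trans ?_
    have hD : ∃ s', wt c s' = wt c s := ⟨s, rfl⟩
    rw [dif_pos hD]
    exact h _ _ hD.choose_spec
  have hcomp : ψ ∘ₗ (aeval (fun i : Fin n => (Polynomial.X : Polynomial k) ^ c i)).toLinearMap
      = (Ideal.Quotient.mkₐ k J).toLinearMap := by
    apply (basisMonomials (Fin n) k).ext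
    intro s
    rw [coe_basisMonomials]
    simp only [LinearMap.comp_apply, AlgHom.toLinearMap_apply]
    rw [aeval_mono, hψ]; rfl
  have := LinearMap.congr_fun hcomp f
  simp only [LinearMap.comp_apply, AlgHom.toLinearMap_apply] at this
  rw [hf, map_zero] at this
  exact Ideal.Quotient.eq_zero_iff_mem.mp this.symm

lemma toric_scale (c : Fin n → ℕ) (g : ℕ) (hg : 0 < g) (A : Fin n → ℕ) (h : ∀ i, A i = g * c i) :
    toricIdeal k A = toricIdeal k c := by
  ext f
  rw [mem_toric, mem_toric]
  have : aeval (fun i : Fin n => (Polynomial.X : Polynomial k) ^ A i) = 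
    (Polynomial.expand k g).comp (aeval (fun i : Fin n => (Polynomial.X : Polynomial k) ^ c i)) := by
    apply MvPolynomial.algHom_ext
    intro i
    simp [h, pow_mul]
  rw [this, AlgHom.comp_apply]
  exact Polynomial.expand_eq_zero hg

end Tor

namespace Tor
open MvPolynomial

lemma nf_unique (e u v Q a b g a' b' g' : ℕ) (he : 0 < e) (hu : 0 < u)
    (hcop : Nat.Coprime (e*u) (v+Q*u)) (hb : b < e) (hb' : b' < e) (hg : g < u) (hg' : g' < u)
    (h : a*(e*u) + b*(v+Q*u) + g*(e*v) = a'*(e*u) + b'*(v+Q*u) + g'*(e*v)) :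
    a = a' ∧ b = b' ∧ g = g' := by
  have c1 : Nat.gcd e (v+Q*u) = 1 := Nat.Coprime.coprime_mul_right hcop
  have c2 : Nat.gcd u v = 1 := by
    have : Nat.Coprime u (v+Q*u) := Nat.Coprime.coprime_mul_left hcop
    simpa using this
  have hbb : b = b' := by
    have h1 : b * (v+Q*u) ≡ b' * (v+Q*u) [MOD e] := by
      have e1 : b * (v+Q*u) ≡ a*(e*u) + b*(v+Q*u) + g*(e*v) [MOD e] := by
        rw [show a*(e*u) + b*(v+Q*u) + g*(e*v) = b*(v+Q*u) + e*(a*u+g*v) by ring]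
        simp [Nat.ModEq]
      have e2 : b' * (v+Q*u) ≡ a'*(e*u) + b'*(v+Q*u) + g'*(e*v) [MOD e] := by
        rw [show a'*(e*u) + b'*(v+Q*u) + g'*(e*v) = b'*(v+Q*u) + e*(a'*u+g'*v) by ring]
        simp [Nat.ModEq]
      rw [h] at e1
      exact e1.trans e2.symm
    exact Nat.ModEq.eq_of_lt_of_lt (Nat.ModEq.cancel_right_of_coprime c1 h1) hb hb'
  subst hbb
  have h2 : a*u + g*v = a'*u + g'*v := by
    apply Nat.eq_of_mul_eq_mul_left he
    nlinarith
  have hgg : g = g' := by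
    have h1 : g * v ≡ g' * v [MOD u] := by
      have e1 : g * v ≡ a*u + g*v [MOD u] := by simp [Nat.ModEq]
      have e2 : g' * v ≡ a'*u + g'*v [MOD u] := by simp [Nat.ModEq]
      rw [h2] at e1
      exact e1.trans e2.symm
    exact Nat.ModEq.eq_of_lt_of_lt (Nat.ModEq.cancel_right_of_coprime c2 h1) hg hg'
  subst hgg
  refine ⟨Nat.eq_of_mul_eq_mul_right hu (by omega), rfl, rfl⟩

lemma red {R : Type*} [CommRing R] (x y z : R) (e u v Q : ℕ) (h1 : y^e = x^Q * z) (h2 : x^v = z^u)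
    (a b g : ℕ) : x^a * y^b * z^g =
      x^(a + Q*(b/e) + v*((g + b/e)/u)) * y^(b % e) * z^((g + b/e) % u) := by
  have e1 : y^b = y^(b%e) * (x^(Q*(b/e)) * z^(b/e)) := by
    conv_lhs => rw [← Nat.mod_add_div b e]
    rw [pow_add, pow_mul, h1, mul_pow, ← pow_mul]
  have e2 : z^(g+b/e) = z^((g+b/e)%u) * x^(v*((g+b/e)/u)) := by
    conv_lhs => rw [← Nat.mod_add_div (g+b/e) u]
    rw [pow_add, pow_mul, ← h2, ← pow_mul]
  calc x^a * y^b * z^g = x^(a+Q*(b/e)) * y^(b%e) * z^(g+b/e) := by rw [e1]; ring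
    _ = _ := by rw [e2]; ring

lemma glue3 (k : Type*) [Field k] (c : Fin 3 → ℕ) (e Q u v : ℕ) (he : 0 < e) (hu : 0 < u)
    (h0 : c 0 = e*u) (h1 : c 1 = v + Q*u) (h2 : c 2 = e*v) (hc : Nat.Coprime (c 0) (c 1)) :
    IsCI k c := by
  let f1 : MvPolynomial (Fin 3) k := X 1 ^ e - X 0 ^ Q * X 2
  let f2 : MvPolynomial (Fin 3) k := X 0 ^ v - X 2 ^ u
  refine ⟨![f1, f2], le_antisymm ?_ ?_⟩
  · rw [Ideal.span_le]
    rintro _ ⟨i, rfl⟩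
    have m1 : f1 ∈ toricIdeal k c := by
      rw [mem_toric]
      simp only [f1, map_sub, map_mul, map_pow, aeval_X, ← pow_mul, ← pow_add]
      rw [h0, h1, h2, show (v+Q*u)*e = e*u*Q + e*v by ring, sub_self]
    have m2 : f2 ∈ toricIdeal k c := by
      rw [mem_toric]
      simp only [f2, map_sub, map_pow, aeval_X, ← pow_mul]
      rw [h0, h2, show e*u*v = e*v*u by ring, sub_self]
    match i with
    | ⟨0, _⟩ => exact m1
    | ⟨1, _⟩ => exact m2
  · apply toric_le
    intro s t hst
    set J := Ideal.span (Set.range ![f1, f2]) with hJ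
    have r1 : Ideal.Quotient.mk J (X 1) ^ e = Ideal.Quotient.mk J (X 0) ^ Q * Ideal.Quotient.mk J (X 2) := by
      rw [← map_pow, ← map_pow, ← map_mul]
      exact Ideal.Quotient.eq.mpr (Ideal.subset_span ⟨0, rfl⟩)
    have r2 : Ideal.Quotient.mk J (X 0) ^ v = Ideal.Quotient.mk J (X 2) ^ u := by
      rw [← map_pow, ← map_pow]
      exact Ideal.Quotient.eq.mpr (Ideal.subset_span ⟨1, rfl⟩)
    have hm : ∀ s : Fin 3 →₀ ℕ, Ideal.Quotient.mk J (monomial s 1) = Ideal.Quotient.mk J (X 0) ^ (s 0)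
        * Ideal.Quotient.mk J (X 1) ^ (s 1) * Ideal.Quotient.mk J (X 2) ^ (s 2) := by
      intro s
      rw [monomial_eq, Finsupp.prod_fintype _ _ (by simp), Fin.prod_univ_three]
      simp
    have hw : ∀ s : Fin 3 →₀ ℕ, wt c s = (s 0 + Q*(s 1/e) + v*((s 2 + s 1/e)/u)) * (e*u)
        + (s 1 % e) * (v + Q*u) + ((s 2 + s 1/e) % u) * (e*v) := by
      intro s
      unfold wt
      rw [Fin.sum_univ_three, h0, h1, h2]
      have a1 := Nat.mod_add_div (s 1) e
      have a2 := Nat.mod_add_div (s 2 + s 1/e) u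
      generalize s 1 / e = b2 at *
      generalize s 1 % e = b1 at *
      generalize (s 2 + b2)/u = g2 at *
      generalize (s 2 + b2)%u = g1 at *
      rw [← a1]
      zify at *
      linear_combination (-(e:ℤ)*v) * a2
    rw [hm, hm, red _ _ _ e u v Q r1 r2, red _ _ _ e u v Q r1 r2 (t 0)]
    rw [hw, hw] at hst
    rw [h0, h1] at hc
    obtain ⟨x1, x2, x3⟩ := nf_unique e u v Q _ _ _ _ _ _ he hu hc (Nat.mod_lt _ he) (Nat.mod_lt _ he)
      (Nat.mod_lt _ hu) (Nat.mod_lt _ hu) hst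
    rw [x1, x2, x3]

/-- the combinatorial core: a CI has a fibre consisting of two or more critical pure powers -/
lemma core (k : Type*) [Field k] {n : ℕ} (hn : 2 ≤ n) (c : Fin n → ℕ) (hc : ∀ i, 0 < c i)
    (h : IsCI k c) : ∃ (m : Fin n → ℕ) (i j : Fin n), i < j ∧ (∀ l, 0 < m l) ∧
      (∀ l x t, wt c t = x * c l → t ≠ Finsupp.single l x → m l ≤ x) ∧
      m i * c i = m j * c j ∧
      (∀ t, wt c t = m i * c i → ∃ l, t = Finsupp.single l (m l)) := by
  classical
  have hex : ∀ i : Fin n, ∃ x, ∃ t, wt c t = x * c i ∧ t ≠ Finsupp.single i x := by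
    intro i
    have : Nontrivial (Fin n) := Fin.nontrivial_iff_two_le.mpr hn
    obtain ⟨j, hj⟩ := exists_ne i
    refine ⟨c j, Finsupp.single j (c i), ?_, ?_⟩
    · rw [wt_single, mul_comm]
    · rw [Ne, Finsupp.single_eq_single_iff]
      rintro (h | h)
      · exact hj h.1
      · exact (hc i).ne' h.1
  let m : Fin n → ℕ := fun i => Nat.find (hex i)
  have hmspec : ∀ i, ∃ t, wt c t = m i * c i ∧ t ≠ Finsupp.single i (m i) := fun i => Nat.find_spec (hex i)
  have hmin : ∀ l x t, wt c t = x * c l → t ≠ Finsupp.single l x → m l ≤ x :=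
    fun l x t h1 h2 => Nat.find_min' (hex l) ⟨t, h1, h2⟩
  have hmpos : ∀ i, 0 < m i := by
    intro i
    rcases Nat.eq_zero_or_pos (m i) with h0 | h0
    · exfalso
      obtain ⟨t, ht, hne⟩ := hmspec i
      rw [h0] at ht hne
      apply hne
      rw [zero_mul, wt, Finset.sum_eq_zero_iff] at ht
      ext j
      have := ht j (Finset.mem_univ _)
      rcases Nat.mul_eq_zero.mp this with h | h
      · simp [h]
      · exact absurd h (hc j).ne'
    · exact h0
  by_contra hcon
  have : ∀ i, ∃ t, wt c t = m i * c i ∧ ∀ l, t ≠ Finsupp.single l (m l) := by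
    intro i
    by_contra hi
    push Not at hi
    obtain ⟨t, ht, hne⟩ := hmspec i
    obtain ⟨j, hj⟩ := hi t ht
    have hij : m i * c i = m j * c j := by rw [← ht, hj, wt_single]
    have hne' : i ≠ j := by rintro rfl; exact hne hj
    rcases lt_or_gt_of_ne hne' with hlt | hlt
    · exact hcon ⟨m, i, j, hlt, hmpos, hmin, hij, hi⟩
    · exact hcon ⟨m, j, i, hlt, hmpos, hmin, hij.symm, fun t ht => hi t (ht.trans hij.symm)⟩
  choose b hb hb' using this
  refine not_CI (by omega) c m ?_ b hb hb' (fun i => (hmpos i).ne') h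
  intro i m' hm' t ht
  by_contra hne
  exact absurd (hmin i m' t ht hne) (by omega)

end Tor

namespace Tor
open MvPolynomial

lemma crit_eq {n : ℕ} (c : Fin n → ℕ) (hc : ∀ i, 0 < c i) (m : Fin n → ℕ) (i j : Fin n) (hij : i ≠ j)
    (hpos : ∀ l, 0 < m l)
    (hmin : ∀ l x t, wt c t = x * c l → t ≠ Finsupp.single l x → m l ≤ x)
    (h : m i * c i = m j * c j) : m i * Nat.gcd (c i) (c j) = c j := by
  have hG : 0 < Nat.gcd (c i) (c j) := Nat.gcd_pos_of_pos_left _ (hc i)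
  obtain ⟨G, x, y, hG', hcop, hx, hy⟩ := Nat.exists_coprime' hG
  have hxpos : 0 < x := by
    rcases Nat.eq_zero_or_pos x with h0 | h0
    · have := hc i; rw [hx, h0] at this; simp at this
    · exact h0
  have hGG : Nat.gcd (c i) (c j) = G := by
    rw [hx, hy, Nat.gcd_mul_right, hcop, one_mul]
  rw [hGG]
  have h1 : m i ≤ y := by
    apply hmin i y (Finsupp.single j x)
    · rw [wt_single, hx, hy]; ring
    · rw [Ne, Finsupp.single_eq_single_iff]
      rintro (h | h)
      · exact hij h.1.symm
      · exact hxpos.ne' h.1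
  have h2 : y ∣ m i := by
    have h3 : m i * x = m j * y := by
      apply Nat.eq_of_mul_eq_mul_right hG'
      rw [hx, hy] at h
      linarith
    exact Nat.Coprime.dvd_of_dvd_mul_right hcop.symm (Dvd.intro_left _ h3.symm)
  have h3 : m i = y := le_antisymm h1 (Nat.le_of_dvd (hpos i) h2)
  rw [h3, hy]

/-- abstract form -/
lemma fwd (k : Type*) [Field k] {n : ℕ} (hn : 3 ≤ n) (C : ℕ → ℕ) (e Q : ℕ) (hC : ∀ i, 0 < C i)
    (hrec : ∀ i, C (i+2) + Q * C i = e * C (i+1)) (hcop : ∀ i, Nat.gcd (C i) (C (i+1)) = 1)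
    (hmono : StrictMono C) (hbig : ∀ i, e * C i < C (i+2)) (he : e < C 0)
    (hCI : IsCI k (fun i : Fin n => C i)) :
    ∃ m j : ℕ, 2 ≤ j ∧ j < n ∧ m < C 1 ∧ m * Nat.gcd (C 0) (C j) = C j ∧
      (j + 1 < n → C 0 ≤ e * Nat.gcd (C 0) (C j)) := by
  obtain ⟨m, i, j, hij, hpos, hmin, heq, hfib⟩ := core k (by omega) _ (fun i : Fin n => hC i) hCI
  have hme : ∀ i : Fin n, 0 < (i:ℕ) → (i:ℕ)+1 < n → m i ≤ e := by
    intro i h0 h1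
    obtain ⟨l, hl⟩ : ∃ l, (i:ℕ) = l + 1 := ⟨i-1, by omega⟩
    apply hmin i e (Finsupp.single ⟨l, by omega⟩ Q + Finsupp.single ⟨l+2, by omega⟩ 1)
    · rw [wt_add, wt_single, wt_single]
      simp only [hl, ← hrec l]; ring
    · intro hh
      have := DFunLike.congr_fun hh ⟨l+2, by omega⟩
      rw [Finsupp.add_apply, Finsupp.single_eq_same, Finsupp.single_eq_of_ne (by
        rw [Ne, Fin.ext_iff]; simp), Finsupp.single_eq_of_ne (by rw [Ne, Fin.ext_iff]; simp [hl])] at this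
      omega
  have k1 := crit_eq _ (fun i : Fin n => hC i) m i j hij.ne hpos hmin heq
  have k2 := crit_eq _ (fun i : Fin n => hC i) m j i hij.ne' hpos hmin heq.symm
  have hij' : (i:ℕ) < j := hij
  have hjn := j.2
  rw [Nat.gcd_comm] at k2
  have hnot1 : m ⟨1, by omega⟩ ≠ C 0 := by
    intro hh
    have := hme ⟨1, by omega⟩ (by simp) (by simp; omega)
    omega
  rcases Nat.eq_zero_or_pos (i:ℕ) with h0 | h0
  · rw [h0] at k1 k2 hij'
    have hj1 : (j:ℕ) ≠ 1 := by
      intro hj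
      rw [hj, hcop 0, mul_one] at k2
      apply hnot1
      rw [← k2]; congr 1; exact Fin.ext hj.symm
    refine ⟨m i, j, by omega, hjn, ?_, k1, ?_⟩
    · by_contra hlt
      push Not at hlt
      obtain ⟨l, hl⟩ := hfib (Finsupp.single i (m i - C 1) + Finsupp.single ⟨1, by omega⟩ (C 0)) (by
        rw [wt_add, wt_single, wt_single]
        simp only [h0]
        obtain ⟨z, hz⟩ := Nat.exists_eq_add_of_le hlt
        rw [hz, Nat.add_sub_cancel_left]; ring)
      have h1 := DFunLike.congr_fun hl ⟨1, by omega⟩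
      rw [Finsupp.add_apply, Finsupp.single_eq_same, Finsupp.single_eq_of_ne (by
        rw [Ne, Fin.ext_iff]; simp [h0])] at h1
      by_cases hl1 : l = ⟨1, by omega⟩
      · rw [hl1, Finsupp.single_eq_same] at h1
        exact hnot1 (by omega)
      · rw [Finsupp.single_eq_of_ne (Ne.symm hl1)] at h1
        have := hC 0
        omega
    · intro hj
      have := hme j (by omega) hj
      calc C 0 = m j * Nat.gcd (C 0) (C j) := k2.symm
        _ ≤ _ := Nat.mul_le_mul_right _ this
  · exfalso
    have h1 := hme i h0 (by omega)
    have h2 : C j ≤ e * Nat.gcd (C i) (C j) := by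
      calc C j = m i * Nat.gcd (C i) (C j) := k1.symm
        _ ≤ _ := Nat.mul_le_mul_right _ h1
    rcases (show (j:ℕ) = i+1 ∨ (i:ℕ)+2 ≤ j by omega) with hj | hj
    · rw [hj, hcop] at h2
      have := hmono.monotone (Nat.zero_le ((i:ℕ)+1))
      omega
    · have h3 := hmono.monotone hj
      have h4 := hbig i
      have h5 : Nat.gcd (C i) (C j) ≤ C i := Nat.gcd_le_left _ (hC i)
      have := Nat.mul_le_mul_left e h5
      omega

end Tor

theorem Tor.heC_arith (C0 C1 C2 e Q : ℕ) (h0 : 0 < C0) (h1 : 0 < C1) (hQ2 : Q * C0 < C2)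
    (hr0 : C2 + Q * C0 = e * C1) (hne : ¬ ∃ x y, C2 = x * C0 + y * C1) : e < C0 := by
  by_contra hle
  push Not at hle
  have key : ∀ t, t * C0 ≤ e → Q ≤ t * C1 → False := by
    intro t ht1 ht2
    obtain ⟨y, hy⟩ := Nat.exists_eq_add_of_le ht1
    obtain ⟨x, hx⟩ := Nat.exists_eq_add_of_le ht2
    apply hne
    refine ⟨x, y, ?_⟩
    zify at *
    rw [hy] at hr0
    linear_combination hr0 + (C0 : ℤ) * hx
  rcases le_or_gt Q (C1) with hh | hh
  · exact key 1 (by omega) (by omega)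
  · have a1 : 2 * C0 < e := by
      by_contra hcon
      push Not at hcon
      have : e * C1 ≤ 2 * C0 * Q := Nat.mul_le_mul hcon hh.le
      nlinarith
    have hdm := Nat.div_add_mod Q (C1)
    have hml := Nat.mod_lt Q h1
    refine key (Q / C1 + 1) ?_ (by nlinarith)
    by_contra hcon
    push Not at hcon
    have b1 : C1 * (Q / C1) ≤ Q := Nat.mul_div_le Q (C1)
    have b2 : C1 * (Q / C1) * C0 ≤ Q * C0 := Nat.mul_le_mul_right _ b1
    have b3 : 2 * e < 2 * (Q / C1) * C0 + e := by nlinarith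
    have b4 : e * C1 < 2 * (Q / C1) * C0 * C1 := Nat.mul_lt_mul_of_pos_right (by linarith) h1
    have b5 : 2 * (Q / C1) * C0 * C1 = 2 * (C1 * (Q / C1) * C0) := by ring
    linarith

set_option maxHeartbeats 1000000 in
/-- With `d_i = L_{a + (i−1)·d}` for `1 ≤ i ≤ n` in the
`(p,q)`-Lucas sequence and `n ≥ 3`, if `d₃ ∉ ℕd₁ + ℕd₂`, then `I_A` is a
complete intersection iff `n = 3`, `d ∣ a`, `a/d` is odd and `gcd(d₁, d₂) = 1`. -/
theorem stmt18 (k : Type*) [Field k] (p q : ℕ) (hp : 0 < p) (hq : 0 < q)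
    (hpq : Nat.gcd p q = 1) (a d : ℕ) (ha : 0 < a) (hd : 0 < d)
    (n : ℕ) (hn : 3 ≤ n)
    (A : Fin n → ℕ) (hA : ∀ i : Fin n, A i = pqLucas p q (a + (i : ℕ) * d))
    (hd3 : ¬ ∃ α β : ℕ, A ⟨2, by omega⟩ = α * A ⟨0, by omega⟩ + β * A ⟨1, by omega⟩) :
    IsCI k A ↔ (n = 3 ∧ d ∣ a ∧ Odd (a / d) ∧
      Nat.gcd (A ⟨0, by omega⟩) (A ⟨1, by omega⟩) = 1) := by
  have hL0 : A ⟨0, by omega⟩ = pqLucas p q a := by rw [hA]; simp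
  have hL1 : A ⟨1, by omega⟩ = pqLucas p q (a+d) := by rw [hA]; simp
  have hL2 : A ⟨2, by omega⟩ = pqLucas p q (a+2*d) := by rw [hA]
  rw [hL0, hL1, hL2] at hd3
  rw [hL0, hL1]
  have hev : Even d := by
    rcases Nat.even_or_odd d with h | h
    · exact h
    · exfalso
      apply hd3
      refine ⟨q^d, pqLucas p q d, ?_⟩
      rw [Luc.id_odd h]; ring
  have hd2 : 2 ≤ d := by
    obtain ⟨r, hr⟩ := hev; omega
  obtain ⟨g, hg⟩ : ∃ g, g = Nat.gcd (pqLucas p q a) (pqLucas p q (a+d)) := ⟨_, rfl⟩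
  have hgpos : 0 < g := by rw [hg]; exact Nat.gcd_pos_of_pos_left _ (Luc.pos hp a)
  have hgall : ∀ i, Nat.gcd (pqLucas p q (a+i*d)) (pqLucas p q (a+(i+1)*d)) = g := by
    intro i; rw [hg]; exact Luc.gcd_all hpq a d hd i
  have hex : ∀ i, ∃ x, pqLucas p q (a+i*d) = g * x := by
    intro i
    have := Nat.gcd_dvd_left (pqLucas p q (a+i*d)) (pqLucas p q (a+(i+1)*d))
    rw [hgall] at this
    exact this
  choose C hC using hex
  obtain ⟨e, he⟩ : ∃ e, e = pqLucas p q d := ⟨_, rfl⟩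
  obtain ⟨Q, hQ⟩ : ∃ Q, Q = q^d := ⟨_, rfl⟩
  have hCpos : ∀ i, 0 < C i := by
    intro i
    rcases Nat.eq_zero_or_pos (C i) with h | h
    · have h1 := hC i
      have := Luc.pos (q := q) hp (a+i*d)
      rw [h1, h] at this; simp at this
    · exact h
  have hrec : ∀ i, C (i+2) + Q * C i = e * C (i+1) := by
    intro i
    apply Nat.eq_of_mul_eq_mul_left hgpos
    have := Luc.id_even (p := p) (q := q) hev (a+i*d)
    rw [show a + i*d+2*d = a+(i+2)*d by ring, show a+i*d+d = a+(i+1)*d by ring, hC, hC, hC,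
      ← he, ← hQ] at this
    linarith
  have hcop : ∀ i, Nat.gcd (C i) (C (i+1)) = 1 := by
    intro i
    have := hgall i
    rw [hC, hC, Nat.gcd_mul_left] at this
    exact Nat.eq_of_mul_eq_mul_left hgpos (by rw [this, mul_one])
  have hmono : StrictMono C := by
    apply strictMono_nat_of_lt_succ
    intro i
    apply Nat.lt_of_mul_lt_mul_left (a := g)
    rw [← hC, ← hC]
    exact Luc.lt_of_lt hp hq (by omega) (by nlinarith)
  have hbig : ∀ i, e * C i < C (i+2) := by
    intro i
    apply Nat.lt_of_mul_lt_mul_left (a := g)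
    rw [← hC, show g * (e * C i) = e * (g * C i) by ring, ← hC, he]
    refine lt_of_le_of_lt (Luc.mul_le hp hq d (a+i*d) hd (by omega) (by omega)) ?_
    exact Luc.lt_of_lt hp hq (by omega) (by nlinarith)
  have hC0 : pqLucas p q a = g * C 0 := by simpa using hC 0
  have hC1 : pqLucas p q (a+d) = g * C 1 := by simpa using hC 1
  have hC2 : pqLucas p q (a+2*d) = g * C 2 := hC 2
  have hQ2 : Q * C 0 < C 2 := by
    apply Nat.lt_of_mul_lt_mul_left (a := g)
    rw [← hC2, show g * (Q * C 0) = Q * (g * C 0) by ring, ← hC0, hQ]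
    exact Luc.qpow_lt hp hq d a hd
  have hr0 : C 2 + Q * C 0 = e * C 1 := hrec 0
  have hne : ¬ ∃ x y, C 2 = x * C 0 + y * C 1 := by
    rintro ⟨x, y, h⟩
    exact hd3 ⟨x, y, by rw [hC2, hC0, hC1, h]; ring⟩
  have heC : e < C 0 := Tor.heC_arith (C 0) (C 1) (C 2) e Q (hCpos 0) (hCpos 1) hQ2 hr0 hne
  have hAC : ∀ i : Fin n, A i = g * (fun i : Fin n => C i) i := by
    intro i; rw [hA]; exact hC i
  have hCIiff : IsCI k A ↔ IsCI k (fun i : Fin n => C i) := by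
    unfold IsCI
    rw [Tor.toric_scale _ g hgpos A hAC]
  rw [hCIiff, ← hg]
  have hepos : 0 < e := by rw [he]; exact Luc.pos hp d
  constructor
  · intro hCI
    obtain ⟨m, j, hj2, hjn, hm, hmj, hjlast⟩ := Tor.fwd k hn C e Q hCpos hrec hcop hmono hbig heC hCI
    rcases (show j = 2 ∨ 3 ≤ j by omega) with hj | hj
    · subst hj
      have hdiv : Nat.gcd (C 0) (C 2) ∣ e := by
        have : Nat.gcd (C 0) (C 2) ∣ e * C 1 := by
          rw [← hr0]
          exact dvd_add (Nat.gcd_dvd_right _ _) ((Nat.gcd_dvd_left _ _).mul_left _)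
        refine Nat.Coprime.dvd_of_dvd_mul_right ?_ this
        exact Nat.Coprime.coprime_dvd_left (Nat.gcd_dvd_left _ _) (hcop 0)
      have hgt : e < 2 * Nat.gcd (C 0) (C 2) := by
        by_contra hcon
        push Not at hcon
        have h1 : C 2 ≤ C 1 * Nat.gcd (C 0) (C 2) := by
          calc C 2 = m * Nat.gcd (C 0) (C 2) := hmj.symm
            _ ≤ _ := Nat.mul_le_mul_right _ hm.le
        have h2 : C 1 * (2 * Nat.gcd (C 0) (C 2)) ≤ C 1 * e := Nat.mul_le_mul_left _ hcon
        nlinarith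
      have hGe : Nat.gcd (C 0) (C 2) = e := by
        obtain ⟨z, hz⟩ := hdiv
        have hz1 : z = 1 := by
          have : z < 2 := by
            by_contra hcon
            push Not at hcon
            have := Nat.mul_le_mul_left (Nat.gcd (C 0) (C 2)) hcon
            omega
          have : z ≠ 0 := by rintro rfl; simp at hz; omega
          omega
        rw [hz1, mul_one] at hz
        exact hz.symm
      have hedvd : e ∣ C 0 := hGe ▸ Nat.gcd_dvd_left _ _
      obtain ⟨t, ht⟩ := Luc.dvd_index hp hq hpq d hd2 a (by
        rw [hC0, ← he]; exact hedvd.mul_left _)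
      have hg1 : g = 1 := by
        apply Luc.gcd_one hp hpq d t g (C 0) hd
        · rw [← ht]; exact hg
        · rw [← ht]; exact hC0
        · rw [← he]; exact hedvd
      refine ⟨?_, ⟨_, ht⟩, ?_, hg1⟩
      · by_contra hn3
        have h1 := hjlast (by omega)
        rw [hGe] at h1
        rw [hg1, one_mul] at hC0
        rw [← hC0, he] at h1 heC
        have ht0 : 1 ≤ t := by
          rcases Nat.eq_zero_or_pos t with h0 | h0
          · rw [h0] at ht; simp at ht; rw [ht] at heC; omega
          · exact h0
        have h2 := Luc.mul_le hp hq d d hd hd (by omega)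
        have h3 := Luc.lt_of_lt hp hq (m := d+d+1) (n := a) (by omega) (by nlinarith)
        omega
      · rw [ht, Nat.mul_div_cancel_left _ hd]
        exact ⟨t, rfl⟩
    · exfalso
      obtain ⟨r, hr⟩ := hev
      have h1 := Luc.gcd_le hp hq hpq (j*r) (by nlinarith) a
      rw [show a + 2*(j*r) = a + j*d by rw [hr]; ring] at h1
      have h2 : pqLucas p q (a+j*d) = m * Nat.gcd (pqLucas p q a) (pqLucas p q (a+j*d)) := by
        rw [hC j, hC0, Nat.gcd_mul_left]
        conv_lhs => rw [← hmj]
        ring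
      have h3 : m < pqLucas p q (a+d) := by
        rw [hC1]; nlinarith
      have h4 := Luc.mul_le hp hq (j*r) (a+d) (by nlinarith) (by omega) (by nlinarith)
      have h5 : a + d + j*r+1 ≤ a + j*d := by
        have : 3 * r ≤ j * r := Nat.mul_le_mul_right r hj
        have : j * d = j*r + j*r := by rw [hr]; ring
        omega
      have h6 := Luc.le_of_le hp hq (by omega) h5
      have h7 := Nat.mul_le_mul_left m h1
      have h8 := Nat.mul_lt_mul_of_pos_right h3 (Luc.pos (q := q) hp (j*r))
      rw [mul_comm] at h4
      omega
  · rintro ⟨hn3, ⟨s, hs⟩, hodd, hg1⟩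
    subst hn3
    rw [hs, Nat.mul_div_cancel_left _ hd] at hodd
    obtain ⟨t, ht⟩ := hodd
    rw [hg1, one_mul] at hC0
    have hdv : e ∣ C 0 := by
      rw [← hC0, hs, ht, he]; exact Luc.odd_mult d t
    obtain ⟨u, hu⟩ := hdv
    have hdv2 : e ∣ C 2 := by
      have w1 : e ∣ Q * C 0 := by rw [hu]; exact (dvd_mul_right _ _).mul_left _
      have w2 : e ∣ C 2 + Q * C 0 := by rw [hr0]; exact dvd_mul_right _ _
      exact (Nat.dvd_add_iff_left w1).mpr w2
    obtain ⟨v, hv⟩ := hdv2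
    refine Tor.glue3 k _ e Q u v hepos ?_ hu ?_ hv (hcop 0)
    · rcases Nat.eq_zero_or_pos u with h | h
      · have := hCpos 0; rw [hu, h] at this; simp at this
      · exact h
    · show C 1 = v + Q * u
      apply Nat.eq_of_mul_eq_mul_left hepos
      rw [← hr0, hu, hv]; ring
end
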